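/- Let (R,P) be a commutative Noetherian local ring, I and J ideals of R, M and N finitely generated R-modules, and i ≥ 0. Assume that both I + ann_R M + ann_R N and J + ann_R M + ann_R N are P-primary. Then length_R(Tor_i^R(M/I^n M, N/J^m N)) is eventually given by a polynomial in m and n if and only if both Tor_i^R(M,N) and Tor_{i−1}^R(M,N) have finite length (with the convention Tor_j = 0 for j < 0). -/

import Mathlib

open CategoryTheory IsLocalRing

/-- `Tor_i^R(M, N)` as an object of `ModuleCat R`. -/
noncomputable def TorM (R : Type) [CommRing R] (i : ℕ)
    (M : Type) [AddCommGroup M] [Module R M]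
    (N : Type) [AddCommGroup N] [Module R N] : ModuleCat R :=
  ((Tor (ModuleCat R) i).obj (ModuleCat.of R M)).obj (ModuleCat.of R N)

/-- The length of a module: the Krull dimension of its lattice of submodules. -/
noncomputable def modLength (R : Type) [CommRing R]
    (M : Type) [AddCommGroup M] [Module R M] : WithBot ℕ∞ :=
  Order.krullDim (Submodule R M)

/-- `f (m, n)` is eventually given by a polynomial in `m` and `n`. -/
def EventuallyPolynomial₂ (f : ℕ → ℕ → WithBot ℕ∞) : Prop :=
  ∃ (p : MvPolynomial (Fin 2) ℚ) (m₀ n₀ : ℕ), ∀ m, m₀ ≤ m → ∀ n, n₀ ≤ n →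
    ∃ c : ℕ, f m n = (c : ℕ∞) ∧ (c : ℚ) = MvPolynomial.eval ![(m : ℚ), (n : ℚ)] p

namespace TorAux

open HomologicalComplex TensorProduct

variable {R : Type} [CommRing R]

/-- The complex `P ⊗ C`. -/
noncomputable def tensorCx (P : ModuleCat.{0} R) (C : ChainComplex (ModuleCat.{0} R) ℕ) :
    ChainComplex (ModuleCat.{0} R) ℕ where
  X i := ModuleCat.of R (P ⊗[R] C.X i)
  d i j := ModuleCat.ofHom ((C.d i j).hom.lTensor P)
  shape i j h := by
    rw [C.shape i j h]
    ext1
    exact LinearMap.lTensor_zero P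
  d_comp_d' i j k _ _ := by
    ext1
    change (C.d j k).hom.lTensor P ∘ₗ (C.d i j).hom.lTensor P = 0
    rw [← LinearMap.lTensor_comp, ← ModuleCat.hom_comp, C.d_comp_d]
    exact LinearMap.lTensor_zero P

/-- The chain map `f ⊗ φ`. -/
noncomputable def chainMap {P P' : ModuleCat.{0} R} {C C' : ChainComplex (ModuleCat.{0} R) ℕ}
    (f : P ⟶ P') (φ : C ⟶ C') : tensorCx P C ⟶ tensorCx P' C' where
  f i := ModuleCat.ofHom (TensorProduct.map f.hom (φ.f i).hom)
  comm' i j _ := by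
    ext1
    change (C'.d i j).hom.lTensor P' ∘ₗ TensorProduct.map f.hom (φ.f i).hom =
      TensorProduct.map f.hom (φ.f j).hom ∘ₗ (C.d i j).hom.lTensor P
    have h : (C'.d i j).hom ∘ₗ (φ.f i).hom = (φ.f j).hom ∘ₗ (C.d i j).hom := by
      rw [← ModuleCat.hom_comp, ← ModuleCat.hom_comp, φ.comm]
    rw [LinearMap.lTensor, LinearMap.lTensor, ← TensorProduct.map_comp, h,
      ← TensorProduct.map_comp, LinearMap.comp_id, LinearMap.id_comp]

lemma tensorCx_hom_ext {P : ModuleCat.{0} R} {C K : ChainComplex (ModuleCat.{0} R) ℕ}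
    {f g : tensorCx P C ⟶ K}
    (h : ∀ i (p : P) (c : C.X i), (f.f i).hom (p ⊗ₜ[R] c) = (g.f i).hom (p ⊗ₜ[R] c)) : f = g := by
  ext1 i
  ext1
  exact TensorProduct.ext' (h i)

lemma chainMap_comp {P P' P'' : ModuleCat.{0} R} {C C' C'' : ChainComplex (ModuleCat.{0} R) ℕ}
    (f : P ⟶ P') (f' : P' ⟶ P'') (φ : C ⟶ C') (φ' : C' ⟶ C'') :
    chainMap (f ≫ f') (φ ≫ φ') = chainMap f φ ≫ chainMap f' φ' :=
  tensorCx_hom_ext fun _ _ _ => rfl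

lemma chainMap_id (P : ModuleCat.{0} R) (C : ChainComplex (ModuleCat.{0} R) ℕ) :
    chainMap (𝟙 P) (𝟙 C) = 𝟙 _ :=
  tensorCx_hom_ext fun _ _ _ => rfl

lemma chainMap_smul_left {P P' : ModuleCat.{0} R} {C C' : ChainComplex (ModuleCat.{0} R) ℕ}
    (r : R) (f : P ⟶ P') (φ : C ⟶ C') : chainMap (r • f) φ = r • chainMap f φ :=
  tensorCx_hom_ext fun _ _ _ => TensorProduct.smul_tmul' _ _ _

lemma chainMap_smul_right {P P' : ModuleCat.{0} R} {C C' : ChainComplex (ModuleCat.{0} R) ℕ}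
    (r : R) (f : P ⟶ P') (φ : C ⟶ C') : chainMap f (r • φ) = r • chainMap f φ :=
  tensorCx_hom_ext fun _ _ _ => TensorProduct.tmul_smul _ _ _

lemma chainMap_add_left {P P' : ModuleCat.{0} R} {C C' : ChainComplex (ModuleCat.{0} R) ℕ}
    (f f' : P ⟶ P') (φ : C ⟶ C') : chainMap (f + f') φ = chainMap f φ + chainMap f' φ :=
  tensorCx_hom_ext fun _ _ _ => TensorProduct.add_tmul _ _ _

lemma chainMap_add_right {P P' : ModuleCat.{0} R} {C C' : ChainComplex (ModuleCat.{0} R) ℕ}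
    (f : P ⟶ P') (φ φ' : C ⟶ C') : chainMap f (φ + φ') = chainMap f φ + chainMap f φ' :=
  tensorCx_hom_ext fun _ _ _ => TensorProduct.tmul_add _ _ _

/-- The complex `tensorCx P C` is `P ⊗ C` in the sense of Mathlib. -/
noncomputable def tensorCxIso (P : ModuleCat.{0} R) (C : ChainComplex (ModuleCat.{0} R) ℕ) :
    ((MonoidalCategory.tensorLeft P).mapHomologicalComplex _).obj C ≅ tensorCx P C :=
  HomologicalComplex.Hom.isoOfComponents (fun _ => Iso.refl _) (fun i j _ => by
    ext1
    exact TensorProduct.ext' fun _ _ => rfl)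

lemma chainMap_homotopy {P : ModuleCat.{0} R} {C C' : ChainComplex (ModuleCat.{0} R) ℕ}
    {φ φ' : C ⟶ C'} (h : Homotopy φ φ') (j : ℕ) :
    homologyMap (chainMap (𝟙 P) φ) j = homologyMap (chainMap (𝟙 P) φ') j := by
  have key : ∀ ψ : C ⟶ C', chainMap (𝟙 P) ψ = (tensorCxIso P C).inv ≫
      ((MonoidalCategory.tensorLeft P).mapHomologicalComplex _).map ψ ≫ (tensorCxIso P C').hom :=
    fun ψ => tensorCx_hom_ext fun _ _ _ => rfl
  rw [key, key, homologyMap_comp, homologyMap_comp, homologyMap_comp, homologyMap_comp,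
    (((MonoidalCategory.tensorLeft P).mapHomotopy h).homologyMap_eq j)]

/-- The complex computing `Tor(P, Q)`. -/
noncomputable abbrev cx (P Q : ModuleCat.{0} R) : ChainComplex (ModuleCat.{0} R) ℕ :=
  tensorCx P (projectiveResolution Q).complex

/-- The map induced on homology by `f` and a lift of `g`. -/
noncomputable def hmap (j : ℕ) {P P' Q Q' : ModuleCat.{0} R} (f : P ⟶ P') (g : Q ⟶ Q') :
    (cx P Q).homology j ⟶ (cx P' Q').homology j :=
  homologyMap (chainMap f (ProjectiveResolution.lift g _ _)) j

lemma hmap_eq (j : ℕ) {P P' Q Q' : ModuleCat.{0} R} (f : P ⟶ P') (g : Q ⟶ Q')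
    (φ : (projectiveResolution Q).complex ⟶ (projectiveResolution Q').complex)
    (hφ : φ ≫ (projectiveResolution Q').π =
      (projectiveResolution Q).π ≫ (ChainComplex.single₀ _).map g) :
    hmap j f g = homologyMap (chainMap f φ) j := by
  have key : ∀ ψ : (projectiveResolution Q).complex ⟶ (projectiveResolution Q').complex,
      chainMap f ψ = chainMap (𝟙 P) ψ ≫ chainMap f (𝟙 _) := fun ψ => by
    rw [← chainMap_comp, Category.id_comp, Category.comp_id]
  rw [hmap, key, key φ, homologyMap_comp, homologyMap_comp,
    chainMap_homotopy (ProjectiveResolution.liftHomotopy g _ _ (by simp) hφ) j]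

lemma hmap_comp (j : ℕ) {P P' P'' Q Q' Q'' : ModuleCat.{0} R} (f : P ⟶ P') (f' : P' ⟶ P'')
    (g : Q ⟶ Q') (g' : Q' ⟶ Q'') :
    hmap j (f ≫ f') (g ≫ g') = hmap j f g ≫ hmap j f' g' := by
  rw [hmap_eq j (f ≫ f') (g ≫ g')
    (ProjectiveResolution.lift g _ _ ≫ ProjectiveResolution.lift g' _ _) (by simp),
    chainMap_comp, homologyMap_comp]
  rfl

lemma hmap_id (j : ℕ) (P Q : ModuleCat.{0} R) : hmap j (𝟙 P) (𝟙 Q) = 𝟙 _ := by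
  rw [hmap_eq j _ _ (𝟙 _) (by simp), chainMap_id, homologyMap_id]

lemma homologyMap_smul' {K L : ChainComplex (ModuleCat.{0} R) ℕ} (r : R) (φ : K ⟶ L) (j : ℕ) :
    homologyMap (r • φ) j = r • homologyMap φ j :=
  ShortComplex.homologyMap_smul (φ := (shortComplexFunctor _ _ j).map φ) r

lemma hmap_smul_left (j : ℕ) {P P' Q Q' : ModuleCat.{0} R} (r : R) (f : P ⟶ P') (g : Q ⟶ Q') :
    hmap j (r • f) g = r • hmap j f g := by
  rw [hmap, chainMap_smul_left, homologyMap_smul', hmap]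

lemma hmap_smul_right (j : ℕ) {P P' Q Q' : ModuleCat.{0} R} (r : R) (f : P ⟶ P') (g : Q ⟶ Q') :
    hmap j f (r • g) = r • hmap j f g := by
  rw [hmap_eq j f (r • g) (r • ProjectiveResolution.lift g _ _), chainMap_smul_right,
    homologyMap_smul', hmap]
  rw [Linear.smul_comp, ProjectiveResolution.lift_commutes, ← Linear.comp_smul]
  congr 1
  ext1
  simp
  rfl

lemma hmap_add_left (j : ℕ) {P P' Q Q' : ModuleCat.{0} R} (f f' : P ⟶ P') (g : Q ⟶ Q') :
    hmap j (f + f') g = hmap j f g + hmap j f' g := by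
  rw [hmap, chainMap_add_left, homologyMap_add, hmap, hmap]

lemma hmap_add_right (j : ℕ) {P P' Q Q' : ModuleCat.{0} R} (f : P ⟶ P') (g g' : Q ⟶ Q') :
    hmap j f (g + g') = hmap j f g + hmap j f g' := by
  rw [hmap_eq j f (g + g') (ProjectiveResolution.lift g _ _ + ProjectiveResolution.lift g' _ _),
    chainMap_add_right, homologyMap_add, hmap, hmap]
  simp [Preadditive.add_comp, Preadditive.comp_add]

/-- The short complex of complexes obtained by tensoring with a resolution of `Q`. -/
noncomputable def cxSeq (S : ShortComplex (ModuleCat.{0} R))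
    (C : ChainComplex (ModuleCat.{0} R) ℕ) : ShortComplex (ChainComplex (ModuleCat.{0} R) ℕ) :=
  ShortComplex.mk (chainMap S.f (𝟙 C)) (chainMap S.g (𝟙 C)) (by
      refine tensorCx_hom_ext fun i p c => ?_
      change (S.g.hom (S.f.hom p)) ⊗ₜ[R] c = 0
      rw [← ModuleCat.comp_apply, S.zero]
      exact TensorProduct.zero_tmul _ _)

lemma cxSeq_shortExact {S : ShortComplex (ModuleCat.{0} R)} (hS : S.ShortExact)
    (C : ChainComplex (ModuleCat.{0} R) ℕ) [∀ i, Projective (C.X i)] :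
    (cxSeq S C).ShortExact := by
  apply HomologicalComplex.shortExact_of_degreewise_shortExact
  intro i
  have hproj : Projective (C.X i) := inferInstance
  rw [← IsProjective.iff_projective] at hproj
  have hex := (ShortComplex.ShortExact.moduleCat_exact_iff_function_exact S).1 hS.exact
  have hinj := hS.moduleCat_injective_f
  have hsurj := hS.moduleCat_surjective_g
  refine { exact := ?_, mono_f := ?_, epi_g := ?_ }
  · rw [ShortComplex.ShortExact.moduleCat_exact_iff_function_exact]
    exact Module.Flat.rTensor_exact _ hex
  · rw [ModuleCat.mono_iff_injective]
    exact Module.Flat.rTensor_preserves_injective_linearMap _ hinj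
  · rw [ModuleCat.epi_iff_surjective]
    exact LinearMap.rTensor_surjective _ hsurj

/-- A commuting diagram of short complexes induces a map of complexes. -/
noncomputable def cxSeqMap {S S' : ShortComplex (ModuleCat.{0} R)} (a : S ⟶ S')
    {C C' : ChainComplex (ModuleCat.{0} R) ℕ} (φ : C ⟶ C') : cxSeq S C ⟶ cxSeq S' C' where
  τ₁ := chainMap a.τ₁ φ
  τ₂ := chainMap a.τ₂ φ
  τ₃ := chainMap a.τ₃ φ
  comm₁₂ := by
    dsimp only [cxSeq]
    rw [← chainMap_comp, ← chainMap_comp, a.comm₁₂, Category.id_comp, Category.comp_id]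
  comm₂₃ := by
    dsimp only [cxSeq]
    rw [← chainMap_comp, ← chainMap_comp, a.comm₂₃, Category.id_comp, Category.comp_id]

end TorAux

namespace TorAux

open HomologicalComplex TensorProduct

variable {R : Type} [CommRing R]

/-- The homology of `cx P Q` is `Tor` in the sense of Mathlib. -/
noncomputable def torIso (j : ℕ) (P Q : ModuleCat.{0} R) :
    ((MonoidalCategory.tensorLeft P).leftDerived j).obj Q ≅ (cx P Q).homology j :=
  (show _ ≅ (((MonoidalCategory.tensorLeft P).mapHomologicalComplex _).obj
      (projectiveResolution Q).complex).homology j from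
    (projectiveResolution Q).isoLeftDerivedObj _ j) ≪≫
    homologyMapIso (tensorCxIso P (projectiveResolution Q).complex) j

lemma torIso_naturality (j : ℕ) (P : ModuleCat.{0} R) {Q Q' : ModuleCat.{0} R} (g : Q ⟶ Q') :
    ((MonoidalCategory.tensorLeft P).leftDerived j).map g ≫ (torIso j P Q').hom =
      (torIso j P Q).hom ≫ hmap j (𝟙 P) g := by
  have h := ProjectiveResolution.isoLeftDerivedObj_hom_naturality g (projectiveResolution Q)
    (projectiveResolution Q') (ProjectiveResolution.lift g _ _)
    (ProjectiveResolution.lift_commutes_zero _ _ _) (MonoidalCategory.tensorLeft P) j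
  have key : ((MonoidalCategory.tensorLeft P).mapHomologicalComplex _).map
      (ProjectiveResolution.lift g (projectiveResolution Q) (projectiveResolution Q')) ≫
      (tensorCxIso P (projectiveResolution Q').complex).hom =
      (tensorCxIso P (projectiveResolution Q).complex).hom ≫
        chainMap (𝟙 P) (ProjectiveResolution.lift g _ _) := by
    ext1 i
    ext1
    exact TensorProduct.ext' fun _ _ => rfl
  have h2 := congrArg (fun φ => homologyMap φ j) key
  simp only [homologyMap_comp] at h2
  exact ((Category.assoc _ _ _).symm.trans
    (congrArg (· ≫ homologyMap (tensorCxIso P (projectiveResolution Q').complex).hom j) h)).trans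
    ((Category.assoc _ _ _).trans ((congrArg
      (((projectiveResolution Q).isoLeftDerivedObj (MonoidalCategory.tensorLeft P) j).hom ≫ ·)
      h2).trans (Category.assoc _ _ _).symm))

/-- The degree zero homology of `cx P Q` is the tensor product. -/
noncomputable def torZeroIso (P Q : ModuleCat.{0} R) :
    (cx P Q).homology 0 ≅ (MonoidalCategory.tensorLeft P).obj Q :=
  (torIso 0 P Q).symm ≪≫ (MonoidalCategory.tensorLeft P).leftDerivedZeroIsoSelf.app Q

lemma torZeroIso_naturality (P : ModuleCat.{0} R) {Q Q' : ModuleCat.{0} R} (g : Q ⟶ Q') :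
    hmap 0 (𝟙 P) g ≫ (torZeroIso P Q').hom =
      (torZeroIso P Q).hom ≫ (MonoidalCategory.tensorLeft P).map g := by
  rw [torZeroIso, torZeroIso, Iso.trans_hom, Iso.trans_hom, Category.assoc,
    ← cancel_epi (torIso 0 P Q).hom, ← Category.assoc, ← torIso_naturality]
  simp

lemma homology_isZero_of_flat (j : ℕ) (P Q : ModuleCat.{0} R) [Module.Flat R P] :
    Limits.IsZero ((cx P Q).homology (j + 1)) := by
  apply ExactAt.isZero_homology
  have h := (projectiveResolution Q).complex_exactAt_succ j
  rw [exactAt_iff' _ (j + 1 + 1) (j + 1) j (by simp) (by simp)] at h ⊢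
  rw [ShortComplex.ShortExact.moduleCat_exact_iff_function_exact] at h ⊢
  exact Module.Flat.lTensor_exact P h

section Unbundled

variable (R) in
/-- `Tor_j(P, Q)`, resolving the second argument. -/
def T (j : ℕ) (P Q : Type) [AddCommGroup P] [Module R P] [AddCommGroup Q] [Module R Q] : Type :=
  ↥((cx (ModuleCat.of R P) (ModuleCat.of R Q)).homology j)

variable {P P' P'' P₁ Q Q' Q'' : Type} [AddCommGroup P] [Module R P] [AddCommGroup P'] [Module R P']
  [AddCommGroup P''] [Module R P''] [AddCommGroup Q] [Module R Q] [AddCommGroup Q'] [Module R Q']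
  [AddCommGroup Q''] [Module R Q'']

noncomputable instance (j : ℕ) : AddCommGroup (T R j P Q) :=
  inferInstanceAs (AddCommGroup ↥((cx (ModuleCat.of R P) (ModuleCat.of R Q)).homology j))

noncomputable instance (j : ℕ) : Module R (T R j P Q) :=
  inferInstanceAs (Module R ↥((cx (ModuleCat.of R P) (ModuleCat.of R Q)).homology j))

namespace T

/-- Functoriality of `T`. -/
noncomputable def map (j : ℕ) (f : P →ₗ[R] P') (g : Q →ₗ[R] Q') : T R j P Q →ₗ[R] T R j P' Q' :=
  (hmap j (ModuleCat.ofHom f) (ModuleCat.ofHom g)).hom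

lemma map_id (j : ℕ) : map j (LinearMap.id : P →ₗ[R] P) (LinearMap.id : Q →ₗ[R] Q) =
    LinearMap.id :=
  congrArg ModuleCat.Hom.hom (hmap_id j (ModuleCat.of R P) (ModuleCat.of R Q))

lemma map_comp (j : ℕ) (f : P →ₗ[R] P') (f' : P' →ₗ[R] P'') (g : Q →ₗ[R] Q')
    (g' : Q' →ₗ[R] Q'') : map j (f' ∘ₗ f) (g' ∘ₗ g) = map j f' g' ∘ₗ map j f g :=
  congrArg ModuleCat.Hom.hom (hmap_comp j (ModuleCat.ofHom f) (ModuleCat.ofHom f')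
    (ModuleCat.ofHom g) (ModuleCat.ofHom g'))

lemma map_smul_left (j : ℕ) (r : R) (f : P →ₗ[R] P') (g : Q →ₗ[R] Q') :
    map j (r • f) g = r • map j f g :=
  congrArg ModuleCat.Hom.hom (hmap_smul_left j r (ModuleCat.ofHom f) (ModuleCat.ofHom g))

lemma map_smul_right (j : ℕ) (r : R) (f : P →ₗ[R] P') (g : Q →ₗ[R] Q') :
    map j f (r • g) = r • map j f g :=
  congrArg ModuleCat.Hom.hom (hmap_smul_right j r (ModuleCat.ofHom f) (ModuleCat.ofHom g))

lemma map_add_left (j : ℕ) (f f' : P →ₗ[R] P') (g : Q →ₗ[R] Q') :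
    map j (f + f') g = map j f g + map j f' g :=
  congrArg ModuleCat.Hom.hom
    (hmap_add_left j (ModuleCat.ofHom f) (ModuleCat.ofHom f') (ModuleCat.ofHom g))

lemma map_add_right (j : ℕ) (f : P →ₗ[R] P') (g g₁ : Q →ₗ[R] Q') :
    map j f (g + g₁) = map j f g + map j f g₁ :=
  congrArg ModuleCat.Hom.hom
    (hmap_add_right j (ModuleCat.ofHom f) (ModuleCat.ofHom g) (ModuleCat.ofHom g₁))

/-- The short complex attached to a short exact sequence. -/
abbrev seq (f : P' →ₗ[R] P) (g : P →ₗ[R] P'') (h : Function.Exact f g) :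
    ShortComplex (ModuleCat.{0} R) :=
  ShortComplex.mk (ModuleCat.ofHom f) (ModuleCat.ofHom g)
    (by ext1; exact h.linearMap_comp_eq_zero)

lemma seq_shortExact {f : P' →ₗ[R] P} {g : P →ₗ[R] P''} (h : Function.Exact f g)
    (hf : Function.Injective f) (hg : Function.Surjective g) : (seq f g h).ShortExact where
  exact := (ShortComplex.ShortExact.moduleCat_exact_iff_function_exact _).2 h
  mono_f := (ModuleCat.mono_iff_injective _).2 hf
  epi_g := (ModuleCat.epi_iff_surjective _).2 hg

/-- The connecting map. -/
noncomputable def δ (j : ℕ) {f : P' →ₗ[R] P} {g : P →ₗ[R] P''} (h : Function.Exact f g)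
    (hf : Function.Injective f) (hg : Function.Surjective g) (Q : Type) [AddCommGroup Q]
    [Module R Q] : T R (j + 1) P'' Q →ₗ[R] T R j P' Q :=
  ((cxSeq_shortExact (seq_shortExact h hf hg)
    (projectiveResolution (ModuleCat.of R Q)).complex).δ (j + 1) j rfl).hom

lemma map_eq_chainMap (j : ℕ) (f : P →ₗ[R] P') : map j f (LinearMap.id : Q →ₗ[R] Q) =
    (homologyMap (chainMap (ModuleCat.ofHom f)
      (𝟙 (projectiveResolution (ModuleCat.of R Q)).complex)) j).hom :=
  congrArg ModuleCat.Hom.hom (hmap_eq j (ModuleCat.ofHom f) (𝟙 (ModuleCat.of R Q)) (𝟙 _) (by simp))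

section
variable (j : ℕ) {f : P' →ₗ[R] P} {g : P →ₗ[R] P''} (h : Function.Exact f g)
    (hf : Function.Injective f) (hg : Function.Surjective g)
include hf hg

include h in
lemma exact₂ : Function.Exact (map j f (LinearMap.id : Q →ₗ[R] Q)) (map j g LinearMap.id) := by
  rw [map_eq_chainMap, map_eq_chainMap]
  exact (ShortComplex.ShortExact.moduleCat_exact_iff_function_exact _).1
    ((cxSeq_shortExact (seq_shortExact h hf hg)
      (projectiveResolution (ModuleCat.of R Q)).complex).homology_exact₂ j)

lemma exact₃ : Function.Exact (map (j + 1) g (LinearMap.id : Q →ₗ[R] Q)) (δ j h hf hg Q) := by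
  rw [map_eq_chainMap]
  exact (ShortComplex.ShortExact.moduleCat_exact_iff_function_exact _).1
    ((cxSeq_shortExact (seq_shortExact h hf hg)
      (projectiveResolution (ModuleCat.of R Q)).complex).homology_exact₃ (j + 1) j rfl)

lemma exact₁ : Function.Exact (δ j h hf hg Q) (map j f (LinearMap.id : Q →ₗ[R] Q)) := by
  rw [map_eq_chainMap]
  exact (ShortComplex.ShortExact.moduleCat_exact_iff_function_exact _).1
    ((cxSeq_shortExact (seq_shortExact h hf hg)
      (projectiveResolution (ModuleCat.of R Q)).complex).homology_exact₁ (j + 1) j rfl)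
end

lemma δ_naturality (j : ℕ) {f : P' →ₗ[R] P} {g : P →ₗ[R] P''} (h : Function.Exact f g)
    (hf : Function.Injective f) (hg : Function.Surjective g)
    {S' S S'' : Type} [AddCommGroup S'] [Module R S'] [AddCommGroup S] [Module R S]
    [AddCommGroup S''] [Module R S'']
    {f₁ : S' →ₗ[R] S} {g₁ : S →ₗ[R] S''} (h₁ : Function.Exact f₁ g₁)
    (hf₁ : Function.Injective f₁) (hg₁ : Function.Surjective g₁)
    (a : P' →ₗ[R] S') (b : P →ₗ[R] S) (c : P'' →ₗ[R] S'')
    (hab : f₁ ∘ₗ a = b ∘ₗ f) (hbc : g₁ ∘ₗ b = c ∘ₗ g) (q : Q →ₗ[R] Q') :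
    map j a q ∘ₗ δ j h hf hg Q = δ j h₁ hf₁ hg₁ Q' ∘ₗ map (j + 1) c q := by
  let t : seq f g h ⟶ seq f₁ g₁ h₁ :=
    { τ₁ := ModuleCat.ofHom a
      τ₂ := ModuleCat.ofHom b
      τ₃ := ModuleCat.ofHom c
      comm₁₂ := by ext1; exact hab
      comm₂₃ := by ext1; exact hbc }
  exact congrArg ModuleCat.Hom.hom (HomologySequence.δ_naturality
    (cxSeqMap t (ProjectiveResolution.lift (ModuleCat.ofHom q)
      (projectiveResolution (ModuleCat.of R Q)) (projectiveResolution (ModuleCat.of R Q'))))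
    (cxSeq_shortExact (seq_shortExact h hf hg) _) (cxSeq_shortExact (seq_shortExact h₁ hf₁ hg₁) _)
    (j + 1) j rfl)

/-- `Tor_0` is the tensor product. -/
noncomputable def zeroEquiv (P Q : Type) [AddCommGroup P] [Module R P] [AddCommGroup Q]
    [Module R Q] : T R 0 P Q ≃ₗ[R] P ⊗[R] Q :=
  (torZeroIso (ModuleCat.of R P) (ModuleCat.of R Q)).toLinearEquiv

lemma zeroEquiv_map (g : Q →ₗ[R] Q') (t : T R 0 P Q) :
    zeroEquiv P Q' (map 0 LinearMap.id g t) = g.lTensor P (zeroEquiv P Q t) :=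
  LinearMap.congr_fun (congrArg ModuleCat.Hom.hom
    (torZeroIso_naturality (ModuleCat.of R P) (ModuleCat.ofHom g))) t

lemma zero_map_right_surjective {g : Q →ₗ[R] Q'} (hg : Function.Surjective g) :
    Function.Surjective (map 0 (LinearMap.id : P →ₗ[R] P) g) := fun t => by
  obtain ⟨s, hs⟩ := LinearMap.lTensor_surjective P hg (zeroEquiv P Q' t)
  obtain ⟨u, rfl⟩ := (zeroEquiv P Q).surjective s
  exact ⟨u, (zeroEquiv P Q').injective (by rw [zeroEquiv_map, hs])⟩

lemma zero_map_right_injective [Module.Flat R P] {g : Q →ₗ[R] Q'} (hg : Function.Injective g) :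
    Function.Injective (map 0 (LinearMap.id : P →ₗ[R] P) g) := fun t s h => by
  apply (zeroEquiv P Q).injective
  apply Module.Flat.lTensor_preserves_injective_linearMap (M := P) g hg
  rw [← zeroEquiv_map, ← zeroEquiv_map, h]

lemma zero_exact_right {f : Q' →ₗ[R] Q} {g : Q →ₗ[R] Q''} (h : Function.Exact f g)
    (hg : Function.Surjective g) : Function.Exact (map 0 (LinearMap.id : P →ₗ[R] P) f)
      (map 0 (LinearMap.id : P →ₗ[R] P) g) := by
  have := lTensor_exact P h hg
  intro t
  rw [← (zeroEquiv P Q'').map_eq_zero_iff, zeroEquiv_map, this]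
  constructor
  · rintro ⟨s, hs⟩
    refine ⟨(zeroEquiv P Q').symm s, (zeroEquiv P Q).injective ?_⟩
    rw [zeroEquiv_map, LinearEquiv.apply_symm_apply, hs]
  · rintro ⟨s, rfl⟩
    exact ⟨zeroEquiv P Q' s, (zeroEquiv_map f s).symm⟩

lemma zero_map_left_surjective {f : P →ₗ[R] P'} (hf : Function.Surjective f) :
    Function.Surjective (map 0 f (LinearMap.id : Q →ₗ[R] Q)) := by
  rw [map_eq_chainMap]
  have : Epi ((chainMap (ModuleCat.ofHom f)
      (𝟙 (projectiveResolution (ModuleCat.of R Q)).complex)).f 0) := by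
    rw [ModuleCat.epi_iff_surjective]
    exact TensorProduct.map_surjective hf Function.surjective_id
  exact (ModuleCat.epi_iff_surjective _).1 (epi_homologyMap_of_epi_of_not_rel _ 0 (by simp))

instance subsingleton_of_flat (j : ℕ) [Module.Flat R P] : Subsingleton (T R (j + 1) P Q) :=
  ModuleCat.subsingleton_of_isZero (homology_isZero_of_flat j (ModuleCat.of R P) (ModuleCat.of R Q))

end T

end Unbundled

end TorAux

namespace TorAux

open HomologicalComplex TensorProduct

variable {R : Type} [CommRing R]

namespace T

variable {P P' P'' Q Q' Q'' : Type} [AddCommGroup P] [Module R P] [AddCommGroup P']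
  [Module R P'] [AddCommGroup P''] [Module R P''] [AddCommGroup Q] [Module R Q] [AddCommGroup Q']
  [Module R Q'] [AddCommGroup Q''] [Module R Q'']

lemma map_map (j : ℕ) (f : P →ₗ[R] P') (f' : P' →ₗ[R] P'') (g : Q →ₗ[R] Q')
    (g' : Q' →ₗ[R] Q'') (x : T R j P Q) :
    map j f' g' (map j f g x) = map j (f' ∘ₗ f) (g' ∘ₗ g) x := by
  rw [map_comp, LinearMap.comp_apply]

lemma δ_injective (j : ℕ) {f : P' →ₗ[R] P} {g : P →ₗ[R] P''} (h : Function.Exact f g)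
    (hf : Function.Injective f) (hg : Function.Surjective g) [Module.Flat R P] :
    Function.Injective (δ j h hf hg Q) := by
  rw [injective_iff_map_eq_zero]
  intro x hx
  obtain ⟨y, rfl⟩ := (exact₃ j h hf hg x).1 hx
  rw [Subsingleton.elim y 0, map_zero]

lemma δ_natural_right (j : ℕ) {f : P' →ₗ[R] P} {g : P →ₗ[R] P''} (h : Function.Exact f g)
    (hf : Function.Injective f) (hg : Function.Surjective g) (q : Q →ₗ[R] Q')
    (x : T R (j + 1) P'' Q) :
    map j LinearMap.id q (δ j h hf hg Q x) = δ j h hf hg Q' (map (j + 1) LinearMap.id q x) :=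
  LinearMap.congr_fun (δ_naturality j h hf hg h hf hg LinearMap.id LinearMap.id LinearMap.id
    rfl rfl q) x

lemma map_right_injective (j : ℕ) [Module.Flat R P] {g : Q →ₗ[R] Q'} (hg : Function.Injective g) :
    Function.Injective (map j (LinearMap.id : P →ₗ[R] P) g) := by
  cases j with
  | zero => exact zero_map_right_injective hg
  | succ j => exact Function.injective_of_subsingleton _

lemma map_comm (j : ℕ) (f : P →ₗ[R] P') (g : Q →ₗ[R] Q') (x : T R j P Q) :
    map j LinearMap.id g (map j f LinearMap.id x) =
      map j f LinearMap.id (map j LinearMap.id g x) := by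
  rw [map_map, map_map]
  rfl

variable (R P) in
lemma exists_flat_cover : ∃ (Z F : Type) (_ : AddCommGroup Z) (_ : Module R Z)
    (_ : AddCommGroup F) (_ : Module R F) (f : Z →ₗ[R] F) (g : F →ₗ[R] P), Module.Flat R F ∧
      Function.Exact f g ∧ Function.Injective f ∧ Function.Surjective g :=
  ⟨LinearMap.ker (Finsupp.linearCombination R (id : P → P)), P →₀ R, inferInstance, inferInstance,
    inferInstance, inferInstance,
    (LinearMap.ker (Finsupp.linearCombination R (id : P → P))).subtype,
    Finsupp.linearCombination R (id : P → P), inferInstance, LinearMap.exact_subtype_ker_map _,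
    (LinearMap.ker (Finsupp.linearCombination R (id : P → P))).injective_subtype,
    Finsupp.linearCombination_id_surjective R P⟩

section
variable {u : Q' →ₗ[R] Q} {v : Q →ₗ[R] Q''} (h : Function.Exact u v)
    (hu : Function.Injective u) (hv : Function.Surjective v)
include h hu hv

variable (P) in
lemma exact_right (j : ℕ) :
    Function.Exact (map j (LinearMap.id : P →ₗ[R] P) u) (map j (LinearMap.id : P →ₗ[R] P) v) := by
  induction j generalizing P with
  | zero => exact zero_exact_right h hv
  | succ j ih =>
    obtain ⟨Z, F, _, _, _, _, f, g, hF, hfg, hf, hg⟩ := exists_flat_cover R P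
    intro x
    constructor
    · intro hx
      have h1 : map j LinearMap.id v (δ j hfg hf hg Q x) = 0 := by
        rw [δ_natural_right, hx, map_zero]
      obtain ⟨y, hy⟩ := (ih Z _).1 h1
      have h2 : map j f LinearMap.id y = 0 := by
        apply map_right_injective j (P := F) hu
        rw [map_zero, map_comm, hy]
        exact (exact₁ j hfg hf hg _).2 ⟨x, rfl⟩
      obtain ⟨z, rfl⟩ := (exact₁ j hfg hf hg _).1 h2
      refine ⟨z, δ_injective j hfg hf hg ?_⟩
      rw [← δ_natural_right, hy]
    · rintro ⟨y, rfl⟩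
      rw [map_map, h.linearMap_comp_eq_zero, ← zero_smul R (0 : Q' →ₗ[R] Q''), map_smul_right,
        zero_smul, LinearMap.zero_apply]

variable (P) in
lemma exists_connecting_right (j : ℕ) : ∃ d : T R (j + 1) P Q'' →ₗ[R] T R j P Q',
    Function.Exact (map (j + 1) (LinearMap.id : P →ₗ[R] P) v) d ∧
      Function.Exact d (map j (LinearMap.id : P →ₗ[R] P) u) := by
  induction j generalizing P with
  | zero =>
    obtain ⟨Z, F, _, _, _, _, f, g, hF, hfg, hf, hg⟩ := exists_flat_cover R P
    have e1 : map 0 (LinearMap.id : F →ₗ[R] F) u ∘ₗ map 0 f LinearMap.id =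
        map 0 f LinearMap.id ∘ₗ map 0 LinearMap.id u := LinearMap.ext (map_comm 0 f u)
    have e2 : map 0 (LinearMap.id : F →ₗ[R] F) v ∘ₗ map 0 f LinearMap.id =
        map 0 f LinearMap.id ∘ₗ map 0 LinearMap.id v := LinearMap.ext (map_comm 0 f v)
    have e3 : map 0 (LinearMap.id : Z →ₗ[R] Z) v ∘ₗ δ 0 hfg hf hg Q =
      δ 0 hfg hf hg Q'' ∘ₗ map 1 LinearMap.id v := LinearMap.ext (δ_natural_right 0 hfg hf hg v)
    have e4 : map 0 (LinearMap.id : P →ₗ[R] P) u ∘ₗ map 0 g LinearMap.id =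
        map 0 g LinearMap.id ∘ₗ map 0 LinearMap.id u := LinearMap.ext (map_comm 0 g u)
    refine ⟨SnakeLemma.δ' (map 0 f LinearMap.id) (map 0 f LinearMap.id) (map 0 f LinearMap.id)
      _ _ (exact_right Z h hu hv 0) _ _ (exact_right F h hu hv 0) e1 e2
      (δ 0 hfg hf hg Q'') (exact₁ 0 hfg hf hg) (map 0 g LinearMap.id) (exact₂ 0 hfg hf hg)
      (zero_map_right_surjective hv) (zero_map_right_injective hu), ?_, ?_⟩
    · apply SnakeLemma.exact_δ'_right (ι₂ := δ 0 hfg hf hg Q)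
      · exact exact₁ 0 hfg hf hg
      · exact e3
      · exact δ_injective 0 hfg hf hg
    · apply SnakeLemma.exact_δ'_left (π₂ := map 0 g (LinearMap.id : Q →ₗ[R] Q))
      · exact exact₂ 0 hfg hf hg
      · exact e4
      · exact zero_map_left_surjective hg
  | succ j ih =>
    obtain ⟨Z, F, _, _, _, _, f, g, hF, hfg, hf, hg⟩ := exists_flat_cover R P
    obtain ⟨d, hd1, hd2⟩ := ih Z
    have hsurj : ∀ (X : Type) [AddCommGroup X] [Module R X],
        Function.Surjective (δ (j + 1) hfg hf hg X) := fun X _ _ y =>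
      (exact₁ (j + 1) hfg hf hg y).1 (Subsingleton.elim _ _)
    have hmem : ∀ x, d (δ (j + 1) hfg hf hg Q'' x) ∈ LinearMap.range (δ j hfg hf hg Q') := by
      intro x
      refine (exact₁ j hfg hf hg _).1 (map_right_injective j (P := F) hu ?_)
      rw [map_comm, (hd2 _).2 ⟨_, rfl⟩, map_zero, map_zero]
    let e := LinearEquiv.ofInjective (δ j hfg hf hg Q') (δ_injective j hfg hf hg)
    let D : T R (j + 1 + 1) P Q'' →ₗ[R] T R (j + 1) P Q' :=
      e.symm.toLinearMap ∘ₗ (d ∘ₗ δ (j + 1) hfg hf hg Q'').codRestrict _ hmem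
    have hD : ∀ x, δ j hfg hf hg Q' (D x) = d (δ (j + 1) hfg hf hg Q'' x) := fun x =>
      congrArg Subtype.val (e.apply_symm_apply ⟨_, hmem x⟩)
    refine ⟨D, fun x => ?_, fun x => ?_⟩
    · rw [← (δ_injective j hfg hf hg (Q := Q')).eq_iff, map_zero, hD, hd1]
      constructor
      · rintro ⟨y, hy⟩
        obtain ⟨z, rfl⟩ := hsurj _ y
        exact ⟨z, δ_injective _ hfg hf hg (by rw [← δ_natural_right, hy])⟩
      · rintro ⟨y, rfl⟩
        exact ⟨δ (j + 1) hfg hf hg Q y, δ_natural_right _ _ _ _ _ _⟩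
    · rw [← (δ_injective j hfg hf hg (Q := Q)).eq_iff, map_zero, ← δ_natural_right, hd2]
      constructor
      · rintro ⟨y, hy⟩
        obtain ⟨z, rfl⟩ := hsurj _ y
        exact ⟨z, δ_injective _ hfg hf hg (by rw [hD, hy])⟩
      · rintro ⟨y, rfl⟩
        exact ⟨_, (hD y).symm⟩

end

lemma length_of_exact {A B C D E : Type} [AddCommGroup A] [Module R A] [AddCommGroup B] [Module R B]
    [AddCommGroup C] [Module R C] [AddCommGroup D] [Module R D] [AddCommGroup E] [Module R E]
    {a : A →ₗ[R] B} {b : B →ₗ[R] C} {c : C →ₗ[R] D} {d : D →ₗ[R] E}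
    (h1 : Function.Exact a b) (h2 : Function.Exact b c) (h3 : Function.Exact c d) :
    Module.length R C = Module.length R (B ⧸ LinearMap.range a) +
      Module.length R (LinearMap.ker d) := by
  have hker : LinearMap.range a ≤ LinearMap.ker b := h1.linearMap_ker_eq.ge
  have hmem : ∀ x, c x ∈ LinearMap.ker d := fun x => (h3 (c x)).2 ⟨x, rfl⟩
  refine Module.length_eq_add_of_exact ((LinearMap.range a).liftQ b hker)
    (c.codRestrict (LinearMap.ker d) hmem) ?_ ?_ ?_
  · rw [← LinearMap.ker_eq_bot]
    exact Submodule.ker_liftQ_eq_bot _ _ _ h1.linearMap_ker_eq.le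
  · rintro ⟨x, hx⟩
    obtain ⟨y, rfl⟩ := (h3 x).1 hx
    exact ⟨y, rfl⟩
  · rw [LinearMap.exact_iff, LinearMap.ker_codRestrict, h2.linearMap_ker_eq,
      Submodule.range_liftQ]

lemma length_right_succ (P : Type) [AddCommGroup P] [Module R P] {u : Q' →ₗ[R] Q} {v : Q →ₗ[R] Q''}
    (h : Function.Exact u v) (hu : Function.Injective u) (hv : Function.Surjective v) (j : ℕ) :
    Module.length R (T R (j + 1) P Q'') = Module.length R (T R (j + 1) P Q ⧸
      LinearMap.range (map (j + 1) (LinearMap.id : P →ₗ[R] P) u)) +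
      Module.length R (LinearMap.ker (map j (LinearMap.id : P →ₗ[R] P) u)) := by
  obtain ⟨d, hd1, hd2⟩ := exists_connecting_right P h hu hv j
  exact length_of_exact (exact_right P h hu hv (j + 1)) hd1 hd2

lemma length_right_zero (P : Type) [AddCommGroup P] [Module R P] {u : Q' →ₗ[R] Q} {v : Q →ₗ[R] Q''}
    (h : Function.Exact u v) (hv : Function.Surjective v) :
    Module.length R (T R 0 P Q'') = Module.length R (T R 0 P Q ⧸
      LinearMap.range (map 0 (LinearMap.id : P →ₗ[R] P) u)) := by
  rw [← (Submodule.quotEquivOfEq _ _ (zero_exact_right (P := P) h hv).linearMap_ker_eq.symm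
    ≪≫ₗ LinearMap.quotKerEquivOfSurjective _ (zero_map_right_surjective hv)).length_eq]

instance finite [IsNoetherianRing R] (j : ℕ) [Module.Finite R P] [Module.Finite R Q] :
    Module.Finite R (T R j P Q) := by
  induction j generalizing P with
  | zero => exact Module.Finite.equiv (zeroEquiv P Q).symm
  | succ j ih =>
    obtain ⟨n, g, hg⟩ := Module.Finite.exists_fin' R P
    exact Module.Finite.of_injective _ (δ_injective j (Q := Q) (LinearMap.exact_subtype_ker_map g)
      (Submodule.injective_subtype _) hg)

lemma smul_eq_zero_left (j : ℕ) {r : R} (hr : ∀ p : P, r • p = 0) (x : T R j P Q) : r • x = 0 := by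
  have h := map_smul_left j r (LinearMap.id : P →ₗ[R] P) (LinearMap.id : Q →ₗ[R] Q)
  have h0 : r • (LinearMap.id : P →ₗ[R] P) = (0 : R) • LinearMap.id :=
    LinearMap.ext fun p => by simp [hr p]
  rw [h0, map_smul_left, map_id] at h
  simpa using (LinearMap.congr_fun h x).symm

lemma smul_eq_zero_right (j : ℕ) {r : R} (hr : ∀ q : Q, r • q = 0) (x : T R j P Q) :
    r • x = 0 := by
  have h := map_smul_right j r (LinearMap.id : P →ₗ[R] P) (LinearMap.id : Q →ₗ[R] Q)
  have h0 : r • (LinearMap.id : Q →ₗ[R] Q) = (0 : R) • LinearMap.id :=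
    LinearMap.ext fun p => by simp [hr p]
  rw [h0, map_smul_right, map_id] at h
  simpa using (LinearMap.congr_fun h x).symm

end T

end TorAux

namespace TorAux

/-- The space of polynomial functions in two variables, spanned by products of binomials. -/
noncomputable def polyFun : Submodule ℚ (ℕ → ℕ → ℚ) :=
  Submodule.span ℚ (Set.range fun (ab : ℕ × ℕ) n m =>
    ((n.choose ab.1 : ℕ) : ℚ) * ((m.choose ab.2 : ℕ) : ℚ))

lemma choose_mem_polyFun (a b : ℕ) :
    (fun n m => ((n.choose a : ℕ) : ℚ) * ((m.choose b : ℕ) : ℚ)) ∈ polyFun :=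
  Submodule.subset_span ⟨(a, b), rfl⟩

lemma exists_antidifference {g : ℕ → ℕ → ℚ} (hg : g ∈ polyFun) :
    ∃ G ∈ polyFun, ∀ n m, G (n + 1) m = G n m + g n m := by
  induction hg using Submodule.span_induction with
  | mem x hx =>
    obtain ⟨⟨a, b⟩, rfl⟩ := hx
    refine ⟨_, choose_mem_polyFun (a + 1) b, fun n m => ?_⟩
    simp only [Nat.choose_succ_succ]
    push_cast
    ring
  | zero => exact ⟨0, zero_mem _, by simp⟩
  | add x y _ _ hx hy =>
    obtain ⟨X, hX, hX'⟩ := hx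
    obtain ⟨Y, hY, hY'⟩ := hy
    refine ⟨X + Y, add_mem hX hY, fun n m => ?_⟩
    simp only [Pi.add_apply, hX', hY']
    ring
  | smul c x _ hx =>
    obtain ⟨X, hX, hX'⟩ := hx
    refine ⟨c • X, Submodule.smul_mem _ _ hX, fun n m => ?_⟩
    simp only [Pi.smul_apply, hX', smul_eq_mul]
    ring

lemma polyFun_freeze {g : ℕ → ℕ → ℚ} (hg : g ∈ polyFun) (n₀ : ℕ) :
    (fun _ m => g n₀ m) ∈ polyFun := by
  induction hg using Submodule.span_induction with
  | mem x hx =>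
    obtain ⟨⟨a, b⟩, rfl⟩ := hx
    convert Submodule.smul_mem _ ((n₀.choose a : ℕ) : ℚ) (choose_mem_polyFun 0 b) using 1
    ext n m
    simp
  | zero => exact zero_mem _
  | add x y _ _ hx hy => exact add_mem hx hy
  | smul c x _ hx => exact Submodule.smul_mem _ c hx

lemma polyFun_swap {g : ℕ → ℕ → ℚ} (hg : g ∈ polyFun) : (fun n m => g m n) ∈ polyFun := by
  induction hg using Submodule.span_induction with
  | mem x hx =>
    obtain ⟨⟨a, b⟩, rfl⟩ := hx
    convert choose_mem_polyFun b a using 1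
    ext n m
    simp [mul_comm]
  | zero => exact zero_mem _
  | add x y _ _ hx hy => exact add_mem hx hy
  | smul c x _ hx => exact Submodule.smul_mem _ c hx

lemma exists_mvPolynomial {g : ℕ → ℕ → ℚ} (hg : g ∈ polyFun) :
    ∃ p : MvPolynomial (Fin 2) ℚ, ∀ n m : ℕ,
      g n m = MvPolynomial.eval ![(n : ℚ), (m : ℚ)] p := by
  induction hg using Submodule.span_induction with
  | mem x hx =>
    obtain ⟨⟨a, b⟩, rfl⟩ := hx
    refine ⟨MvPolynomial.C ((a.factorial : ℚ)⁻¹ * (b.factorial : ℚ)⁻¹) *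
      (Polynomial.aeval (MvPolynomial.X 0) (descPochhammer ℚ a) *
        Polynomial.aeval (MvPolynomial.X 1) (descPochhammer ℚ b)), fun n m => ?_⟩
    have key : ∀ (i : Fin 2) (q : Polynomial ℚ), MvPolynomial.eval ![(n : ℚ), (m : ℚ)]
        (Polynomial.aeval (MvPolynomial.X i) q) = q.eval (![(n : ℚ), (m : ℚ)] i) := by
      intro i q
      rw [Polynomial.aeval_def, Polynomial.hom_eval₂, MvPolynomial.eval_X]
      congr 1
      exact RingHom.ext_rat _ _
    rw [map_mul, MvPolynomial.eval_C, map_mul, key, key]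
    dsimp only
    rw [Nat.cast_choose_eq_descPochhammer_div,
      Nat.cast_choose_eq_descPochhammer_div]
    simp only [Matrix.cons_val_zero, Matrix.cons_val_one]
    field_simp
  | zero => exact ⟨0, by simp⟩
  | add x y _ _ hx hy =>
    obtain ⟨X, hX⟩ := hx
    obtain ⟨Y, hY⟩ := hy
    exact ⟨X + Y, fun n m => by simp [hX, hY]⟩
  | smul c x _ hx =>
    obtain ⟨X, hX⟩ := hx
    exact ⟨c • X, fun n m => by simp [hX, MvPolynomial.smul_eval]⟩

/-- `f` eventually agrees with a polynomial function. -/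
def EvPoly (f : ℕ → ℕ → ℚ) : Prop :=
  ∃ g ∈ polyFun, ∃ N, ∀ n ≥ N, ∀ m ≥ N, f n m = g n m

namespace EvPoly

variable {f g : ℕ → ℕ → ℚ}

lemma congr (hf : EvPoly f) (N : ℕ) (h : ∀ n ≥ N, ∀ m ≥ N, g n m = f n m) : EvPoly g := by
  obtain ⟨p, hp, N', hN'⟩ := hf
  exact ⟨p, hp, max N N', fun n hn m hm => by
    rw [h n (le_of_max_le_left hn) m (le_of_max_le_left hm),
      hN' n (le_of_max_le_right hn) m (le_of_max_le_right hm)]⟩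

lemma add (hf : EvPoly f) (hg : EvPoly g) : EvPoly fun n m => f n m + g n m := by
  obtain ⟨p, hp, N, hN⟩ := hf
  obtain ⟨q, hq, N', hN'⟩ := hg
  exact ⟨p + q, add_mem hp hq, max N N', fun n hn m hm => by
    simp only [Pi.add_apply, hN n (le_of_max_le_left hn) m (le_of_max_le_left hm),
      hN' n (le_of_max_le_right hn) m (le_of_max_le_right hm)]⟩

lemma sub (hf : EvPoly f) (hg : EvPoly g) : EvPoly fun n m => f n m - g n m := by
  obtain ⟨p, hp, N, hN⟩ := hf
  obtain ⟨q, hq, N', hN'⟩ := hg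
  exact ⟨p - q, sub_mem hp hq, max N N', fun n hn m hm => by
    simp only [Pi.sub_apply, hN n (le_of_max_le_left hn) m (le_of_max_le_left hm),
      hN' n (le_of_max_le_right hn) m (le_of_max_le_right hm)]⟩

lemma swap (hf : EvPoly f) : EvPoly fun n m => f m n := by
  obtain ⟨p, hp, N, hN⟩ := hf
  exact ⟨_, polyFun_swap hp, N, fun n hn m hm => hN m hm n hn⟩

lemma const (c : ℚ) : EvPoly fun _ _ => c :=
  ⟨c • _, Submodule.smul_mem _ c (choose_mem_polyFun 0 0), 0, fun n _ m _ => by simp⟩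

lemma freeze (hf : EvPoly f) : ∃ N, ∀ n₀ ≥ N, EvPoly fun _ m => f n₀ m := by
  obtain ⟨p, hp, N, hN⟩ := hf
  exact ⟨N, fun n₀ h₀ => ⟨_, polyFun_freeze hp n₀, N, fun _ _ m hm => hN n₀ h₀ m hm⟩⟩

lemma of_difference (h1 : EvPoly fun n m => f (n + 1) m - f n m)
    (h2 : ∃ N, ∀ n₀ ≥ N, EvPoly fun _ m => f n₀ m) : EvPoly f := by
  obtain ⟨p, hp, N, hN⟩ := h1
  obtain ⟨P, hP, hP'⟩ := exists_antidifference hp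
  obtain ⟨N', hN'⟩ := h2
  have h3 := (hN' (max N N') (le_max_right _ _)).sub ⟨_, polyFun_freeze hP (max N N'), 0,
    fun _ _ _ _ => rfl⟩
  refine (h3.add ⟨P, hP, 0, fun _ _ _ _ => rfl⟩).congr (max N N') fun n hn m hm => ?_
  induction n, hn using Nat.le_induction with
  | base => ring
  | succ n hn ih =>
    have := hN n (le_of_max_le_left hn) m (le_of_max_le_left hm)
    rw [hP']
    linarith

lemma of_differences (h1 : EvPoly fun n m => f (n + 1) m - f n m)
    (h2 : EvPoly fun n m => f n (m + 1) - f n m) : EvPoly f := by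
  refine h1.of_difference ?_
  obtain ⟨N, hN⟩ := h2.freeze
  exact ⟨N, fun n₀ h₀ => ((hN n₀ h₀).swap.of_difference (f := fun n _ => f n₀ n)
    ⟨0, fun _ _ => const _⟩).swap⟩

end EvPoly

end TorAux

namespace TorAux

/-- A family of modules indexed by `ℕ × ℕ` with commuting operators raising the indices. -/
structure Fam (R : Type) [CommRing R] (σ τ : Type) where
  E : ℕ → ℕ → Type
  [acg : ∀ n m, AddCommGroup (E n m)]
  [mod : ∀ n m, Module R (E n m)]
  X : σ → ∀ n m, E n m →ₗ[R] E (n + 1) m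
  Y : τ → ∀ n m, E n m →ₗ[R] E n (m + 1)
  XX : ∀ k l n m x, X k _ _ (X l n m x) = X l _ _ (X k n m x)
  YY : ∀ k l n m x, Y k _ _ (Y l n m x) = Y l _ _ (Y k n m x)
  XY : ∀ k l n m x, X k _ _ (Y l n m x) = Y l _ _ (X k n m x)

attribute [instance] Fam.acg Fam.mod

namespace Fam

variable {R : Type} [CommRing R] {σ τ : Type} (F : Fam R σ τ)

/-- The family with the two indices exchanged. -/
def swap : Fam R τ σ where
  E n m := F.E m n
  X k n m := F.Y k m n
  Y k n m := F.X k m n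
  XX k l n m x := F.YY k l m n x
  YY k l n m x := F.XX k l m n x
  XY k l n m x := (F.XY l k m n x).symm

/-- The family with shifted indices. -/
def shift (N : ℕ) : Fam R σ τ where
  E n m := F.E (N + n) (N + m)
  X k n m := F.X k (N + n) (N + m)
  Y k n m := F.Y k (N + n) (N + m)
  XX k l _ _ x := F.XX k l _ _ x
  YY k l _ _ x := F.YY k l _ _ x
  XY k l _ _ x := F.XY k l _ _ x

/-- A collection of submodules stable under the operators. -/
structure Stable (W : ∀ n m, Submodule R (F.E n m)) : Prop where
  X : ∀ k n m, W n m ≤ (W (n + 1) m).comap (F.X k n m)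
  Y : ∀ k n m, W n m ≤ (W n (m + 1)).comap (F.Y k n m)

/-- The direct sum of all the modules of the family. -/
abbrev Total : Type := DirectSum (ℕ × ℕ) fun p => F.E p.1 p.2

/-- The operators on the direct sum. -/
noncomputable def op : σ ⊕ τ → Module.End R F.Total
  | .inl k => DirectSum.toModule R _ _ fun p =>
      DirectSum.lof R (ℕ × ℕ) (fun p => F.E p.1 p.2) (p.1 + 1, p.2) ∘ₗ F.X k p.1 p.2
  | .inr k => DirectSum.toModule R _ _ fun p =>
      DirectSum.lof R (ℕ × ℕ) (fun p => F.E p.1 p.2) (p.1, p.2 + 1) ∘ₗ F.Y k p.1 p.2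

/-- The inclusion of a summand. -/
noncomputable abbrev incl (n m : ℕ) : F.E n m →ₗ[R] F.Total :=
  DirectSum.lof R (ℕ × ℕ) (fun p => F.E p.1 p.2) (n, m)

lemma op_inl (k : σ) (n m : ℕ) (x : F.E n m) :
    F.op (.inl k) (F.incl n m x) = F.incl (n + 1) m (F.X k n m x) := by
  simp [op, incl]

lemma op_inr (k : τ) (n m : ℕ) (x : F.E n m) :
    F.op (.inr k) (F.incl n m x) = F.incl n (m + 1) (F.Y k n m x) := by
  simp [op, incl]

lemma op_comm (a b : σ ⊕ τ) : F.op a * F.op b = F.op b * F.op a := by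
  refine DirectSum.linearMap_ext R fun p => LinearMap.ext fun x => ?_
  change F.op a (F.op b (F.incl p.1 p.2 x)) = F.op b (F.op a (F.incl p.1 p.2 x))
  rcases a with a | a <;> rcases b with b | b
  · simp only [op_inl, F.XX a b]
  · simp only [op_inl, op_inr, F.XY]
  · simp only [op_inl, op_inr, F.XY]
  · simp only [op_inr, F.YY a b]

/-- The algebra generated by the operators. -/
noncomputable abbrev opAlg : Subalgebra R (Module.End R F.Total) :=
  Algebra.adjoin R (Set.range F.op)

open scoped IsMulCommutative in
lemma opAlg_isNoetherianRing [Finite σ] [Finite τ] [IsNoetherianRing R] :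
    IsNoetherianRing F.opAlg := by
  have : IsMulCommutative F.opAlg := Algebra.isMulCommutative_adjoin R (by
    rintro _ ⟨a, rfl⟩ _ ⟨b, rfl⟩
    exact F.op_comm a b)
  have : Algebra.FiniteType R F.opAlg :=
    ⟨(Subalgebra.fg_top _).2 ⟨(Set.finite_range F.op).toFinset, by simp⟩⟩
  exact Algebra.FiniteType.isNoetherianRing R F.opAlg

/-- A stable submodule of the total module over the algebra of operators. -/
noncomputable def stableSubmodule (S : Submodule R F.Total) (hS : ∀ a, S ≤ S.comap (F.op a)) :
    Submodule F.opAlg F.Total where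
  __ := S
  smul_mem' := by
    rintro ⟨b, hb⟩
    change ∀ {x}, x ∈ S → b x ∈ S
    induction hb using Algebra.adjoin_induction with
    | mem b hb =>
      obtain ⟨a, rfl⟩ := hb
      exact fun hx => hS a hx
    | algebraMap r => exact fun hx => S.smul_mem r hx
    | add b c _ _ hb hc => exact fun hx => S.add_mem (hb hx) (hc hx)
    | mul b c _ _ hb hc => exact fun hx => hb (hc hx)

/-- The submodule of the direct sum attached to a family of submodules. -/
noncomputable def sumSubmodule (W : ∀ n m, Submodule R (F.E n m)) : Submodule R F.Total :=
  ⨆ p : ℕ × ℕ, (W p.1 p.2).map (F.incl p.1 p.2)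

lemma incl_mem_sumSubmodule {W : ∀ n m, Submodule R (F.E n m)} {n m : ℕ} {x : F.E n m}
    (hx : x ∈ W n m) : F.incl n m x ∈ F.sumSubmodule W :=
  Submodule.mem_iSup_of_mem (n, m) ⟨x, hx, rfl⟩

lemma mem_of_incl_mem {W : ∀ n m, Submodule R (F.E n m)} {n m : ℕ} {x : F.E n m}
    (hx : F.incl n m x ∈ F.sumSubmodule W) : x ∈ W n m := by
  have key : F.sumSubmodule W ≤
      (W n m).comap (DirectSum.component R (ℕ × ℕ) (fun p => F.E p.1 p.2) (n, m)) := by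
    refine iSup_le fun p => ?_
    rintro _ ⟨y, hy, rfl⟩
    by_cases hp : p = (n, m)
    · subst hp
      simpa using hy
    · rw [Submodule.mem_comap, DirectSum.component.of, dif_neg hp]
      exact zero_mem _
  simpa using key hx

lemma sumSubmodule_stable {W : ∀ n m, Submodule R (F.E n m)} (hW : F.Stable W) (a : σ ⊕ τ) :
    F.sumSubmodule W ≤ (F.sumSubmodule W).comap (F.op a) := by
  refine iSup_le fun p => ?_
  rintro _ ⟨y, hy, rfl⟩
  rw [Submodule.mem_comap]
  rcases a with k | k
  · rw [op_inl]
    exact F.incl_mem_sumSubmodule (hW.X k _ _ hy)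
  · rw [op_inr]
    exact F.incl_mem_sumSubmodule (hW.Y k _ _ hy)

lemma sumSubmodule_mono {W W' : ∀ n m, Submodule R (F.E n m)} (h : ∀ n m, W n m ≤ W' n m) :
    F.sumSubmodule W ≤ F.sumSubmodule W' :=
  iSup_mono fun _ => Submodule.map_mono (h _ _)

lemma total_finite [Module.Finite R (F.E 0 0)]
    (hX : ∀ n m, ⊤ ≤ ⨆ k, LinearMap.range (F.X k n m))
    (hY : ∀ n m, ⊤ ≤ ⨆ k, LinearMap.range (F.Y k n m)) : Module.Finite F.opAlg F.Total := by
  obtain ⟨s, hs⟩ := Module.Finite.fg_top (R := R) (M := F.E 0 0)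
  classical
  refine ⟨⟨s.image (F.incl 0 0), ?_⟩⟩
  set S := Submodule.span F.opAlg ((s.image (F.incl 0 0) : Finset F.Total) : Set F.Total)
  have hop : ∀ a, ∀ x ∈ S, F.op a x ∈ S := fun a x hx =>
    S.smul_mem ⟨F.op a, Algebra.subset_adjoin ⟨a, rfl⟩⟩ hx
  have h00 : (⊤ : Submodule R (F.E 0 0)) ≤ (S.restrictScalars R).comap (F.incl 0 0) := by
    rw [← hs, Submodule.span_le]
    intro x hx
    exact Submodule.subset_span (Finset.mem_coe.2 (Finset.mem_image_of_mem _ hx))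
  have hn0 : ∀ n, (⊤ : Submodule R (F.E n 0)) ≤ (S.restrictScalars R).comap (F.incl n 0) := by
    intro n
    induction n with
    | zero => exact h00
    | succ n ih =>
      refine (hX n 0).trans (iSup_le fun k => ?_)
      rintro _ ⟨y, rfl⟩
      rw [Submodule.mem_comap, ← op_inl]
      exact hop _ _ (ih trivial)
  have hnm : ∀ m n, (⊤ : Submodule R (F.E n m)) ≤ (S.restrictScalars R).comap (F.incl n m) := by
    intro m
    induction m with
    | zero => exact hn0
    | succ m ih =>
      intro n
      refine (hY n m).trans (iSup_le fun k => ?_)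
      rintro _ ⟨y, rfl⟩
      rw [Submodule.mem_comap, ← op_inr]
      exact hop _ _ (ih n trivial)
  rw [eq_top_iff]
  intro x _
  induction x using DirectSum.induction_on with
  | zero => exact zero_mem _
  | of p x => exact hnm p.2 p.1 trivial
  | add x y hx hy => exact add_mem (hx trivial) (hy trivial)

lemma exists_stable_X_of_generated [Finite σ] [Finite τ] [IsNoetherianRing R]
    [Module.Finite R (F.E 0 0)]
    (hX : ∀ n m, ⊤ ≤ ⨆ k, LinearMap.range (F.X k n m))
    (hY : ∀ n m, ⊤ ≤ ⨆ k, LinearMap.range (F.Y k n m))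
    {W : ∀ n m, Submodule R (F.E n m)} (hW : F.Stable W) :
    ∃ N, ∀ n ≥ N, ∀ m, W (n + 1) m ≤ ⨆ k, (W n m).map (F.X k n m) := by
  have := F.total_finite hX hY
  have := F.opAlg_isNoetherianRing
  have hnoeth : IsNoetherian F.opAlg F.Total :=
    isNoetherian_of_isNoetherianRing_of_finite F.opAlg F.Total
  let U : ℕ → ∀ n m, Submodule R (F.E n m) := fun N n => match n with
    | 0 => fun m => W 0 m
    | n + 1 => fun m => if N ≤ n then ⨆ k, (W n m).map (F.X k n m) else W (n + 1) m
  have hle : ∀ n m, ⨆ k, (W n m).map (F.X k n m) ≤ W (n + 1) m := fun n m =>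
    iSup_le fun k => Submodule.map_le_iff_le_comap.2 (hW.X k n m)
  have hUW : ∀ N n m, U N n m ≤ W n m := by
    rintro N (_ | n) m
    · exact le_rfl
    · by_cases h : N ≤ n
      · simpa only [U, if_pos h] using hle n m
      · simp only [U, if_neg h, le_refl]
  have hU : ∀ N, F.Stable (U N) := by
    refine fun N => ⟨fun k n m x hx => ?_, ?_⟩
    · have h1 : F.X k n m x ∈ ⨆ k, (W n m).map (F.X k n m) :=
        Submodule.mem_iSup_of_mem k ⟨x, hUW N n m hx, rfl⟩
      rw [Submodule.mem_comap]
      by_cases h : N ≤ n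
      · simpa only [U, if_pos h] using h1
      · simpa only [U, if_neg h] using hle n m h1
    · rintro l (_ | n) m x hx
      · exact hW.Y l 0 m hx
      · by_cases h : N ≤ n
        · simp only [U, if_pos h] at hx
          have h1 : (⨆ k, (W n m).map (F.X k n m)) ≤
              (⨆ k, (W n (m + 1)).map (F.X k n (m + 1))).comap (F.Y l (n + 1) m) := by
            refine iSup_le fun k => ?_
            rintro _ ⟨y, hy, rfl⟩
            rw [Submodule.mem_comap, ← F.XY]
            exact Submodule.mem_iSup_of_mem k ⟨_, hW.Y l n m hy, rfl⟩
          rw [Submodule.mem_comap]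
          simpa only [U, if_pos h] using Submodule.mem_comap.1 (h1 hx)
        · simp only [U, if_neg h] at hx
          rw [Submodule.mem_comap]
          simpa only [U, if_neg h] using Submodule.mem_comap.1 (hW.Y l (n + 1) m hx)
  have hmono : ∀ N N', N ≤ N' → ∀ n m, U N n m ≤ U N' n m := by
    rintro N N' hN (_ | n) m
    · exact le_rfl
    · by_cases h : N' ≤ n
      · simp only [U, if_pos h, if_pos (hN.trans h), le_refl]
      · simp only [U, if_neg h]
        exact hUW N (n + 1) m
  let f : ℕ →o Submodule F.opAlg F.Total :=
    ⟨fun N => F.stableSubmodule (F.sumSubmodule (U N)) (F.sumSubmodule_stable (hU N)),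
      fun N N' h => F.sumSubmodule_mono (hmono N N' h)⟩
  obtain ⟨N, hN⟩ := monotone_stabilizes_iff_noetherian.2 hnoeth f
  refine ⟨N, fun n hn m x hx => ?_⟩
  have h1 : F.incl (n + 1) m x ∈ f (n + 1) := by
    refine F.incl_mem_sumSubmodule (W := U (n + 1)) ?_
    simpa only [U, if_neg (Nat.not_succ_le_self n)] using hx
  rw [← hN (n + 1) (by omega)] at h1
  have h2 := F.mem_of_incl_mem (W := U N) h1
  simpa only [U, if_pos hn] using h2

/-- Eventual finite generation. -/
structure EFG : Prop where
  finite : ∀ n m, Module.Finite R (F.E n m)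
  gen : ∃ N, ∀ n ≥ N, ∀ m ≥ N, ⊤ ≤ ⨆ k, LinearMap.range (F.X k n m) ∧
    ⊤ ≤ ⨆ k, LinearMap.range (F.Y k n m)

variable {F}

lemma EFG.swap (h : F.EFG) : F.swap.EFG where
  finite n m := h.finite m n
  gen := by
    obtain ⟨N, hN⟩ := h.gen
    exact ⟨N, fun n hn m hm => (hN m hm n hn).symm⟩

lemma Stable.swap {W : ∀ n m, Submodule R (F.E n m)} (hW : F.Stable W) :
    F.swap.Stable fun n m => W m n :=
  ⟨fun k n m => hW.Y k m n, fun k n m => hW.X k m n⟩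

lemma EFG.exists_stable_X [Finite σ] [Finite τ] [IsNoetherianRing R] (h : F.EFG)
    {W : ∀ n m, Submodule R (F.E n m)} (hW : F.Stable W) :
    ∃ N, ∀ n ≥ N, ∀ m ≥ N, W (n + 1) m ≤ ⨆ k, (W n m).map (F.X k n m) := by
  obtain ⟨N, hN⟩ := h.gen
  have : Module.Finite R ((F.shift N).E 0 0) := h.finite _ _
  obtain ⟨N', hN'⟩ := (F.shift N).exists_stable_X_of_generated
    (fun n m => (hN _ (Nat.le_add_right N n) _ (Nat.le_add_right N m)).1)
    (fun n m => (hN _ (Nat.le_add_right N n) _ (Nat.le_add_right N m)).2)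
    (W := fun n m => W (N + n) (N + m)) ⟨fun k n m => hW.X k _ _, fun k n m => hW.Y k _ _⟩
  refine ⟨N + N', fun n hn m hm => ?_⟩
  obtain ⟨n, rfl⟩ := Nat.exists_eq_add_of_le (show N ≤ n by omega)
  obtain ⟨m, rfl⟩ := Nat.exists_eq_add_of_le (show N ≤ m by omega)
  exact hN' n (by omega) m

lemma EFG.exists_stable [Finite σ] [Finite τ] [IsNoetherianRing R] (h : F.EFG)
    {W : ∀ n m, Submodule R (F.E n m)} (hW : F.Stable W) :
    ∃ N, ∀ n ≥ N, ∀ m ≥ N, W (n + 1) m ≤ ⨆ k, (W n m).map (F.X k n m) ∧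
      W n (m + 1) ≤ ⨆ k, (W n m).map (F.Y k n m) := by
  obtain ⟨N, hN⟩ := h.exists_stable_X hW
  obtain ⟨N', hN'⟩ := h.swap.exists_stable_X hW.swap
  exact ⟨N + N', fun n hn m hm => ⟨hN n (by omega) m (by omega),
    hN' m (by omega) n (by omega)⟩⟩

end Fam

end TorAux

namespace TorAux

/-- The length of a module as a rational number (`0` if the length is infinite). -/
noncomputable def len (R : Type) [CommRing R] (E : Type) [AddCommGroup E] [Module R E] : ℚ :=
  ((Module.length R E).toNat : ℚ)

section len

variable {R : Type} [CommRing R] {A B C : Type} [AddCommGroup A] [Module R A]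
  [AddCommGroup B] [Module R B] [AddCommGroup C] [Module R C]

lemma len_congr (e : A ≃ₗ[R] B) : len R A = len R B := by
  rw [len, len, e.length_eq]

lemma len_eq_zero [Subsingleton A] : len R A = 0 := by
  rw [len, Module.length_eq_zero]
  rfl

lemma len_of_exact {f : A →ₗ[R] B} {g : B →ₗ[R] C} (hf : Function.Injective f)
    (hg : Function.Surjective g) (h : Function.Exact f g) (hB : IsFiniteLength R B) :
    len R B = len R A + len R C := by
  have hA := hB.of_injective hf
  have hC := hB.of_surjective hg
  rw [← Module.length_ne_top_iff] at hA hC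
  rw [len, len, len, Module.length_eq_add_of_exact f g hf hg h, ENat.toNat_add hA hC]
  push_cast
  rfl

lemma len_quotient (W : Submodule R A) (hA : IsFiniteLength R A) :
    len R A = len R W + len R (A ⧸ W) :=
  len_of_exact W.injective_subtype W.mkQ_surjective (LinearMap.exact_subtype_mkQ W) hA

lemma len_ker_range (f : A →ₗ[R] B) (hA : IsFiniteLength R A) :
    len R A = len R (LinearMap.ker f) + len R (LinearMap.range f) :=
  len_of_exact (Submodule.injective_subtype _) f.surjective_rangeRestrict
    (by
      intro x
      rw [← LinearMap.mem_ker, LinearMap.ker_rangeRestrict]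
      simp) hA

lemma len_sub_len (f : A →ₗ[R] B) (hA : IsFiniteLength R A) (hB : IsFiniteLength R B) :
    len R B - len R A = len R (B ⧸ LinearMap.range f) - len R (LinearMap.ker f) := by
  rw [len_ker_range f hA, len_quotient (LinearMap.range f) hB]
  ring

end len

namespace Fam

variable {R : Type} [CommRing R] {σ τ : Type} (F : Fam R σ τ)

/-- The family of submodules attached to a stable collection. -/
def sub {W : ∀ n m, Submodule R (F.E n m)} (hW : F.Stable W) : Fam R σ τ where
  E n m := W n m
  X k n m := (F.X k n m).restrict (hW.X k n m)
  Y k n m := (F.Y k n m).restrict (hW.Y k n m)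
  XX k l n m x := Subtype.ext (F.XX k l n m x)
  YY k l n m x := Subtype.ext (F.YY k l n m x)
  XY k l n m x := Subtype.ext (F.XY k l n m x)

/-- The family of quotients by a stable collection. -/
def quot {W : ∀ n m, Submodule R (F.E n m)} (hW : F.Stable W) : Fam R σ τ where
  E n m := F.E n m ⧸ W n m
  X k n m := (W n m).mapQ _ (F.X k n m) (hW.X k n m)
  Y k n m := (W n m).mapQ _ (F.Y k n m) (hW.Y k n m)
  XX k l n m x := by
    obtain ⟨x, rfl⟩ := Submodule.Quotient.mk_surjective _ x
    simp only [Submodule.mapQ_apply, F.XX k l]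
  YY k l n m x := by
    obtain ⟨x, rfl⟩ := Submodule.Quotient.mk_surjective _ x
    simp only [Submodule.mapQ_apply, F.YY k l]
  XY k l n m x := by
    obtain ⟨x, rfl⟩ := Submodule.Quotient.mk_surjective _ x
    simp only [Submodule.mapQ_apply, F.XY k l]

/-- Reindexing the operators. -/
def reindex {σ' τ' : Type} (e : σ' → σ) (d : τ' → τ) : Fam R σ' τ' where
  E := F.E
  X k := F.X (e k)
  Y k := F.Y (d k)
  XX k l := F.XX (e k) (e l)
  YY k l := F.YY (d k) (d l)
  XY k l := F.XY (e k) (d l)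

/-- Shift of the first index by one. -/
def succ : Fam R σ τ where
  E n m := F.E (n + 1) m
  X k n := F.X k (n + 1)
  Y k n := F.Y k (n + 1)
  XX k l n := F.XX k l (n + 1)
  YY k l n := F.YY k l (n + 1)
  XY k l n := F.XY k l (n + 1)

variable {F}

lemma EFG.succ (h : F.EFG) : F.succ.EFG where
  finite n m := h.finite (n + 1) m
  gen := by
    obtain ⟨N, hN⟩ := h.gen
    exact ⟨N, fun n hn m hm => hN (n + 1) (by omega) m hm⟩

lemma EFG.of_surjective {σ' τ' : Type} {G : Fam R σ' τ'} (h : F.EFG)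
    (φ : ∀ n m, F.E n m →ₗ[R] G.E n m) (hφ : ∀ n m, Function.Surjective (φ n m))
    (hX : ∀ k n m x, φ (n + 1) m (F.X k n m x) ∈ ⨆ l, LinearMap.range (G.X l n m))
    (hY : ∀ k n m x, φ n (m + 1) (F.Y k n m x) ∈ ⨆ l, LinearMap.range (G.Y l n m)) : G.EFG where
  finite n m := by
    have := h.finite n m
    exact Module.Finite.of_surjective (φ n m) (hφ n m)
  gen := by
    obtain ⟨N, hN⟩ := h.gen
    refine ⟨N, fun n hn m hm => ⟨?_, ?_⟩⟩
    · rw [← LinearMap.range_eq_top.2 (hφ (n + 1) m), LinearMap.range_eq_map,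
        Submodule.map_le_iff_le_comap]
      refine (hN n hn m hm).1.trans (iSup_le fun k => ?_)
      rintro _ ⟨x, rfl⟩
      exact hX k n m x
    · rw [← LinearMap.range_eq_top.2 (hφ n (m + 1)), LinearMap.range_eq_map,
        Submodule.map_le_iff_le_comap]
      refine (hN n hn m hm).2.trans (iSup_le fun k => ?_)
      rintro _ ⟨x, rfl⟩
      exact hY k n m x

lemma EFG.of_surjective' {G : Fam R σ τ} (h : F.EFG)
    (φ : ∀ n m, F.E n m →ₗ[R] G.E n m) (hφ : ∀ n m, Function.Surjective (φ n m))
    (hX : ∀ k n m x, φ (n + 1) m (F.X k n m x) = G.X k n m (φ n m x))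
    (hY : ∀ k n m x, φ n (m + 1) (F.Y k n m x) = G.Y k n m (φ n m x)) : G.EFG :=
  h.of_surjective φ hφ
    (fun k n m x => Submodule.mem_iSup_of_mem k ⟨φ n m x, (hX k n m x).symm⟩)
    (fun k n m x => Submodule.mem_iSup_of_mem k ⟨φ n m x, (hY k n m x).symm⟩)

lemma EFG.quot (h : F.EFG) {W : ∀ n m, Submodule R (F.E n m)} (hW : F.Stable W) :
    (F.quot hW).EFG :=
  h.of_surjective' (fun n m => (W n m).mkQ) (fun n m => (W n m).mkQ_surjective)
    (fun _ _ _ _ => rfl) (fun _ _ _ _ => rfl)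

lemma EFG.sub [Finite σ] [Finite τ] [IsNoetherianRing R] (h : F.EFG)
    {W : ∀ n m, Submodule R (F.E n m)} (hW : F.Stable W) : (F.sub hW).EFG where
  finite n m := by
    have := h.finite n m
    exact inferInstanceAs (Module.Finite R (W n m))
  gen := by
    have aux : ∀ {A B κ : Type} [AddCommGroup A] [Module R A] [AddCommGroup B] [Module R B]
        (V : Submodule R A) (V' : Submodule R B) (f : κ → A →ₗ[R] B)
        (hf : ∀ k, V ≤ V'.comap (f k)), V' ≤ ⨆ k, V.map (f k) →
        ⊤ ≤ ⨆ k, LinearMap.range ((f k).restrict (hf k)) := by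
      intro A B κ _ _ _ _ V V' f hf h
      rw [← Submodule.map_le_map_iff_of_injective V'.injective_subtype, Submodule.map_top,
        Submodule.range_subtype, Submodule.map_iSup]
      refine h.trans (iSup_mono fun k => ?_)
      rintro _ ⟨x, hx, rfl⟩
      exact ⟨_, ⟨⟨x, hx⟩, rfl⟩, rfl⟩
    obtain ⟨N, hN⟩ := h.exists_stable hW
    exact ⟨N, fun n hn m hm => ⟨aux _ _ _ (fun k => hW.X k n m) (hN n hn m hm).1,
      aux _ _ _ (fun k => hW.Y k n m) (hN n hn m hm).2⟩⟩

lemma EFG.reindex_surjective (h : F.EFG) {σ' τ' : Type} {e : σ' → σ} {e' : τ' → τ}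
    (he : Function.Surjective e) (he' : Function.Surjective e') : (F.reindex e e').EFG :=
  h.of_surjective (fun _ _ => LinearMap.id) (fun _ _ => Function.surjective_id)
    (fun k n m x => by
      obtain ⟨l, rfl⟩ := he k
      exact Submodule.mem_iSup_of_mem l ⟨x, rfl⟩)
    (fun k n m x => by
      obtain ⟨l, rfl⟩ := he' k
      exact Submodule.mem_iSup_of_mem l ⟨x, rfl⟩)

lemma EFG.reindex_castSucc {r : ℕ} {F : Fam R (Fin (r + 1)) τ} (h : F.EFG)
    (h0 : ∀ n m x, F.X (Fin.last r) n m x = 0) : (F.reindex Fin.castSucc id).EFG :=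
  h.of_surjective (fun _ _ => LinearMap.id) (fun _ _ => Function.surjective_id)
    (fun k n m x => by
      induction k using Fin.lastCases with
      | last =>
        rw [h0]
        exact zero_mem _
      | cast k => exact Submodule.mem_iSup_of_mem k ⟨x, rfl⟩)
    (fun k n m x => Submodule.mem_iSup_of_mem k ⟨x, rfl⟩)

lemma EFG.evPoly_fin_zero {F : Fam R (Fin 0) τ} (h : F.EFG) :
    EvPoly fun n m => len R (F.E n m) := by
  obtain ⟨N, hN⟩ := h.gen
  refine (EvPoly.const 0).congr (N + 1) fun n hn m hm => ?_
  obtain ⟨n, rfl⟩ := Nat.exists_eq_add_of_le' (show 1 ≤ n by omega)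
  have h1 := (hN n (by omega) m (by omega)).1
  rw [iSup_of_empty] at h1
  have : Subsingleton (F.E (n + 1) m) :=
    (Submodule.subsingleton_iff R).1 (subsingleton_of_bot_eq_top (top_le_iff.1 h1).symm.symm)
  exact len_eq_zero

lemma EFG.evPoly_sub {r : ℕ} [Finite τ] [IsNoetherianRing R] {F : Fam R (Fin (r + 1)) τ}
    (h : F.EFG) (hF : ∀ n m, IsFiniteLength R (F.E n m))
    (ih : ∀ G : Fam R (Fin r) τ, G.EFG → (∀ n m, IsFiniteLength R (G.E n m)) →
      EvPoly fun n m => len R (G.E n m)) :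
    EvPoly fun n m => len R (F.E (n + 1) m) - len R (F.E n m) := by
  have hker : F.Stable fun n m => LinearMap.ker (F.X (Fin.last r) n m) := by
    refine ⟨fun k n m x hx => ?_, fun k n m x hx => ?_⟩
    · rw [Submodule.mem_comap, LinearMap.mem_ker, F.XX, LinearMap.mem_ker.1 hx, map_zero]
    · rw [Submodule.mem_comap, LinearMap.mem_ker, F.XY, LinearMap.mem_ker.1 hx, map_zero]
  have hran : F.succ.Stable fun n m => LinearMap.range (F.X (Fin.last r) n m) := by
    refine ⟨fun k n m => ?_, fun k n m => ?_⟩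
    · rintro _ ⟨x, rfl⟩
      exact ⟨F.X k n m x, F.XX _ _ _ _ _⟩
    · rintro _ ⟨x, rfl⟩
      exact ⟨F.Y k n m x, F.XY _ _ _ _ _⟩
  have h1 := ih _ ((h.sub hker).reindex_castSucc fun n m x => Subtype.ext x.2)
    fun n m => (hF n m).of_injective (Submodule.injective_subtype _)
  have h2 := ih _ ((h.succ.quot hran).reindex_castSucc fun n m x => by
      obtain ⟨x, rfl⟩ := Submodule.Quotient.mk_surjective _ x
      exact (Submodule.Quotient.mk_eq_zero _).2 ⟨x, rfl⟩)
    fun n m => (hF (n + 1) m).of_surjective (Submodule.mkQ_surjective _)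
  refine (h2.sub h1).congr 0 fun n _ m _ => ?_
  exact len_sub_len _ (hF n m) (hF (n + 1) m)

lemma EFG.evPoly_fin [IsNoetherianRing R] (r s : ℕ) : ∀ F : Fam R (Fin r) (Fin s), F.EFG →
    (∀ n m, IsFiniteLength R (F.E n m)) → EvPoly fun n m => len R (F.E n m) := by
  induction r generalizing s with
  | zero => exact fun F h _ => h.evPoly_fin_zero
  | succ r ihr =>
    induction s with
    | zero => exact fun F h _ => (evPoly_fin_zero h.swap).swap
    | succ s ihs =>
      intro F h hF
      refine EvPoly.of_differences (h.evPoly_sub hF (ihr (s + 1))) ?_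
      exact (h.swap.evPoly_sub (fun n m => hF m n) fun G hG hG' =>
        (ihs G.swap hG.swap fun n m => hG' m n).swap).swap

lemma EFG.evPoly [Finite σ] [Finite τ] [IsNoetherianRing R] (h : F.EFG)
    (hF : ∀ n m, IsFiniteLength R (F.E n m)) : EvPoly fun n m => len R (F.E n m) := by
  obtain ⟨r, ⟨e⟩⟩ := Finite.exists_equiv_fin σ
  obtain ⟨s, ⟨e'⟩⟩ := Finite.exists_equiv_fin τ
  exact EFG.evPoly_fin r s _ (h.reindex_surjective e.symm.surjective e'.symm.surjective) hF

end Fam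

end TorAux

namespace TorAux

variable {R : Type} [CommRing R]

namespace T

variable {P P' Q Q' : Type} [AddCommGroup P] [Module R P] [AddCommGroup P']
  [Module R P'] [AddCommGroup Q] [Module R Q] [AddCommGroup Q'] [Module R Q']

lemma map_sum_left {κ : Type} (j : ℕ) (s : Finset κ) (f : κ → P →ₗ[R] P') (g : Q →ₗ[R] Q') :
    map j (∑ k ∈ s, f k) g = ∑ k ∈ s, map j (f k) g :=
  map_sum (⟨⟨fun f => map j f g, fun f f' => map_add_left j f f' g⟩,
    fun r f => map_smul_left j r f g⟩ : (P →ₗ[R] P') →ₗ[R] T R j P Q →ₗ[R] T R j P' Q') f s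

lemma map_sum_right {κ : Type} (j : ℕ) (s : Finset κ) (f : P →ₗ[R] P') (g : κ → Q →ₗ[R] Q') :
    map j f (∑ k ∈ s, g k) = ∑ k ∈ s, map j f (g k) :=
  map_sum (⟨⟨fun g => map j f g, fun g g' => map_add_right j f g g'⟩,
    fun r g => map_smul_right j r f g⟩ : (Q →ₗ[R] Q') →ₗ[R] T R j P Q →ₗ[R] T R j P' Q') g s

lemma sum_proj_surjective {A B : Type} [AddCommGroup A] [Module R A]
    [AddCommGroup B] [Module R B] {κ : Type} [Fintype κ] {f : κ → A →ₗ[R] B}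
    (h : ⊤ ≤ ⨆ k, LinearMap.range (f k)) :
    Function.Surjective (∑ k, f k ∘ₗ LinearMap.proj k : (κ → A) →ₗ[R] B) := by
  classical
  rw [← LinearMap.range_eq_top, ← top_le_iff]
  refine h.trans (iSup_le fun k => ?_)
  rintro _ ⟨x, rfl⟩
  refine ⟨Pi.single k x, ?_⟩
  rw [LinearMap.sum_apply, Finset.sum_eq_single k]
  · simp
  · intro l _ hl
    simp [hl]
  · simp

lemma zero_range_left {κ : Type} [Finite κ] {f : κ → P →ₗ[R] P'}
    (h : ⊤ ≤ ⨆ k, LinearMap.range (f k)) :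
    ⊤ ≤ ⨆ k, LinearMap.range (map 0 (f k) (LinearMap.id : Q →ₗ[R] Q)) := by
  cases nonempty_fintype κ
  intro x _
  obtain ⟨y, rfl⟩ := zero_map_left_surjective (Q := Q) (sum_proj_surjective h) x
  rw [map_sum_left, LinearMap.sum_apply]
  refine sum_mem fun k _ => Submodule.mem_iSup_of_mem k ?_
  have := map_comp 0 (LinearMap.proj k : (κ → P) →ₗ[R] P) (f k)
    (LinearMap.id : Q →ₗ[R] Q) LinearMap.id
  rw [LinearMap.comp_id] at this
  rw [this]
  exact LinearMap.mem_range_self _ _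

lemma zero_range_right {κ : Type} [Finite κ] {g : κ → Q →ₗ[R] Q'}
    (h : ⊤ ≤ ⨆ k, LinearMap.range (g k)) :
    ⊤ ≤ ⨆ k, LinearMap.range (map 0 (LinearMap.id : P →ₗ[R] P) (g k)) := by
  cases nonempty_fintype κ
  intro x _
  obtain ⟨y, rfl⟩ := zero_map_right_surjective (P := P) (sum_proj_surjective h) x
  rw [map_sum_right, LinearMap.sum_apply]
  refine sum_mem fun k _ => Submodule.mem_iSup_of_mem k ?_
  have := map_comp 0 (LinearMap.id : P →ₗ[R] P) LinearMap.id
    (LinearMap.proj k : (κ → Q) →ₗ[R] Q) (g k)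
  rw [LinearMap.comp_id] at this
  rw [this]
  exact LinearMap.mem_range_self _ _

end T

/-- A sequence of submodules of a module with an action of a polynomial ring, such that
the variables raise the degree by one. -/
structure GrMod (R : Type) [CommRing R] (σ : Type) where
  A : Type
  [acg : AddCommGroup A]
  [mod : Module R A]
  ρ : MvPolynomial σ R →ₐ[R] Module.End R A
  P : ℕ → Submodule R A
  stable : ∀ k n, P n ≤ (P (n + 1)).comap (ρ (MvPolynomial.X k))

attribute [instance] GrMod.acg GrMod.mod

namespace GrMod

variable {σ τ : Type}

/-- The variables as operators. -/
noncomputable def x (G : GrMod R σ) (k : σ) (n : ℕ) : G.P n →ₗ[R] G.P (n + 1) :=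
  (G.ρ (MvPolynomial.X k)).restrict (G.stable k n)

lemma x_comm (G : GrMod R σ) (k l : σ) (n : ℕ) :
    G.x k (n + 1) ∘ₗ G.x l n = G.x l (n + 1) ∘ₗ G.x k n := by
  refine LinearMap.ext fun p => Subtype.ext ?_
  change (G.ρ (MvPolynomial.X k) * G.ρ (MvPolynomial.X l)) p =
    (G.ρ (MvPolynomial.X l) * G.ρ (MvPolynomial.X k)) p
  rw [← map_mul, ← map_mul, mul_comm]

/-- Eventual finite generation. -/
structure EFG (G : GrMod R σ) : Prop where
  finite : ∀ n, Module.Finite R (G.P n)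
  gen : ∃ N, ∀ n ≥ N, ⊤ ≤ ⨆ k, LinearMap.range (G.x k n)

/-- Shifting the index. -/
def shift (G : GrMod R σ) (N : ℕ) : GrMod R σ where
  A := G.A
  ρ := G.ρ
  P n := G.P (N + n)
  stable k n := G.stable k (N + n)

/-- The family of Tor modules. -/
noncomputable def torFam (j : ℕ) (G : GrMod R σ) (H : GrMod R τ) : Fam R σ τ where
  E n m := T R j (G.P n) (H.P m)
  X k n m := T.map j (G.x k n) LinearMap.id
  Y k n m := T.map j LinearMap.id (H.x k m)
  XX k l n m t := by rw [T.map_map, T.map_map, x_comm]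
  YY k l n m t := by rw [T.map_map, T.map_map, x_comm]
  XY k l n m t := (T.map_comm j _ _ t).symm

/-- The family of the modules themselves, constant in the second variable. -/
noncomputable def toFam (G : GrMod R σ) : Fam R σ Unit where
  E n _ := G.P n
  X k n _ := G.x k n
  Y _ _ _ := LinearMap.id
  XX k l n _ t := LinearMap.congr_fun (G.x_comm k l n) t
  YY _ _ _ _ _ := rfl
  XY _ _ _ _ _ := rfl

lemma EFG.toFam {G : GrMod R σ} (h : G.EFG) : G.toFam.EFG where
  finite n _ := h.finite n
  gen := by
    obtain ⟨N, hN⟩ := h.gen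
    exact ⟨N, fun n hn m _ => ⟨hN n hn, fun x _ => Submodule.mem_iSup_of_mem () ⟨x, rfl⟩⟩⟩

section free

variable (R σ) (ι : Type)

/-- The homogeneous components of a free module over the polynomial ring. -/
noncomputable abbrev free : GrMod R σ where
  A := ι → MvPolynomial σ R
  ρ := Algebra.lsmul R R (ι → MvPolynomial σ R)
  P n := Submodule.pi Set.univ fun _ => MvPolynomial.homogeneousSubmodule σ R n
  stable k n f hf i _ := by
    have := (MvPolynomial.isHomogeneous_X R k).mul (hf i trivial)
    rwa [add_comm] at this

variable {R σ}

lemma homogeneousSubmodule_succ_le (n : ℕ) :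
    MvPolynomial.homogeneousSubmodule σ R (n + 1) ≤
    ⨆ k, (MvPolynomial.homogeneousSubmodule σ R n).map
      (LinearMap.mulLeft R (MvPolynomial.X k)) := by
  have h := MvPolynomial.homogeneousSubmodule_one_pow (σ := σ) (R := R) (n + 1)
  rw [← h, pow_succ', MvPolynomial.homogeneousSubmodule_one_pow,
    MvPolynomial.homogeneousSubmodule_one_eq_span_X,
    Submodule.mul_le]
  intro a ha b hb
  induction ha using Submodule.span_induction with
  | mem a ha =>
    obtain ⟨k, rfl⟩ := ha
    exact Submodule.mem_iSup_of_mem k ⟨b, hb, rfl⟩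
  | zero => rw [zero_mul]; exact zero_mem _
  | add a a' _ _ h h' => rw [add_mul]; exact add_mem h h'
  | smul r a _ h => rw [smul_mul_assoc]; exact Submodule.smul_mem _ r h

/-- The homogeneous components of the free module as powers. -/
def freeEquiv (n : ℕ) :
    (free R σ ι).P n ≃ₗ[R] (ι → MvPolynomial.homogeneousSubmodule σ R n) where
  toFun p i := ⟨p.1 i, p.2 i trivial⟩
  invFun q := ⟨fun i => (q i).1, fun i _ => (q i).2⟩
  map_add' _ _ := rfl
  map_smul' _ _ := rfl

lemma free_flat (n : ℕ) [Finite ι] : Module.Flat R ((free R σ ι).P n) := by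
  have h1 : Module.Free R (MvPolynomial.homogeneousSubmodule σ R n) := by
    rw [MvPolynomial.homogeneousSubmodule_eq_finsupp_supported]
    exact Module.Free.of_equiv (AddMonoidAlgebra.supportedEquivFinsupp _).symm
  have h2 : Module.Free R ((free R σ ι).P n) := Module.Free.of_equiv (freeEquiv ι n).symm
  infer_instance

lemma free_P_succ_le (n : ℕ) [Finite ι] : (free R σ ι).P (n + 1) ≤
    ⨆ k, ((free R σ ι).P n).map ((free R σ ι).ρ (MvPolynomial.X k)) := by
  classical
  cases nonempty_fintype ι
  intro p hp
  rw [← Finset.univ_sum_single p]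
  refine sum_mem fun i _ => ?_
  have h1 : (⨆ k, (MvPolynomial.homogeneousSubmodule σ R n).map
      (LinearMap.mulLeft R (MvPolynomial.X k))) ≤
      (⨆ k, ((free R σ ι).P n).map ((free R σ ι).ρ (MvPolynomial.X k))).comap
        (LinearMap.single R (fun _ : ι => MvPolynomial σ R) i) := by
    refine iSup_le fun k => ?_
    rintro _ ⟨q, hq, rfl⟩
    refine Submodule.mem_iSup_of_mem k ⟨Pi.single i q, fun l _ => ?_, ?_⟩
    · by_cases hl : l = i
      · subst hl
        simpa using hq
      · simp [Pi.single_eq_of_ne hl]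
    · exact (Pi.single_smul (f := fun _ : ι => MvPolynomial σ R) i
        (MvPolynomial.X k : MvPolynomial σ R) q).symm
  exact h1 (homogeneousSubmodule_succ_le n (hp i trivial))

lemma free_finite [Finite ι] [Finite σ] (n : ℕ) : Module.Finite R ((free R σ ι).P n) := by
  have : Module.Finite R (MvPolynomial.homogeneousSubmodule σ R n) :=
    Module.Finite.iff_fg.2 (MvPolynomial.homogeneousSubmodule_fg σ R n)
  exact Module.Finite.equiv (freeEquiv ι n).symm

end free

lemma top_le_iff_P_le (G : GrMod R σ) (n : ℕ) : ⊤ ≤ ⨆ k, LinearMap.range (G.x k n) ↔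
    G.P (n + 1) ≤ ⨆ k, (G.P n).map (G.ρ (MvPolynomial.X k)) := by
  rw [← Submodule.map_le_map_iff_of_injective (G.P (n + 1)).injective_subtype, Submodule.map_top,
    Submodule.range_subtype, Submodule.map_iSup]
  have : ∀ k, (LinearMap.range (G.x k n)).map (G.P (n + 1)).subtype =
      (G.P n).map (G.ρ (MvPolynomial.X k)) := fun k => by
    rw [← LinearMap.range_comp]
    ext y
    constructor
    · rintro ⟨z, rfl⟩
      exact ⟨z, z.2, rfl⟩
    · rintro ⟨z, hz, rfl⟩
      exact ⟨⟨z, hz⟩, rfl⟩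
  simp_rw [this]

lemma free_EFG (ι : Type) [Finite ι] [Finite σ] : (free R σ ι).EFG where
  finite n := free_finite ι n
  gen := ⟨0, fun n _ => (top_le_iff_P_le _ n).2 (free_P_succ_le ι n)⟩

section cover

variable (G : GrMod R σ) {ι : Type} [Fintype ι] (p : ι → G.P 0)

/-- The map from the free module given by elements of degree zero. -/
noncomputable def cover : (ι → MvPolynomial σ R) →ₗ[R] G.A :=
  ∑ i, LinearMap.applyₗ (p i : G.A) ∘ₗ G.ρ.toLinearMap ∘ₗ LinearMap.proj i

lemma cover_apply (f : ι → MvPolynomial σ R) : G.cover p f = ∑ i, G.ρ (f i) (p i : G.A) := by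
  rw [cover, LinearMap.sum_apply]
  rfl

lemma cover_smul (a : MvPolynomial σ R) (f : ι → MvPolynomial σ R) :
    G.cover p ((free R σ ι).ρ a f) = G.ρ a (G.cover p f) := by
  have h : (free R σ ι).ρ a f = fun i => a * f i := rfl
  rw [h, cover_apply, cover_apply, map_sum]
  simp only [map_mul]
  rfl

lemma cover_map_succ (n : ℕ) (hG : ⊤ ≤ ⨆ k, LinearMap.range (G.x k n))
    (h : ((free R σ ι).P n).map (G.cover p) = G.P n) :
    ((free R σ ι).P (n + 1)).map (G.cover p) = G.P (n + 1) := by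
  apply le_antisymm
  · refine (Submodule.map_mono (free_P_succ_le ι n)).trans ?_
    rw [Submodule.map_iSup]
    refine iSup_le fun k => ?_
    rintro _ ⟨_, ⟨y, hy, rfl⟩, rfl⟩
    rw [cover_smul]
    exact G.stable k n (h ▸ Submodule.mem_map_of_mem hy)
  · refine ((top_le_iff_P_le G n).1 hG).trans (iSup_le fun k => ?_)
    rw [← h]
    rintro _ ⟨_, ⟨y, hy, rfl⟩, rfl⟩
    exact ⟨_, (free R σ ι).stable k n hy, cover_smul _ _ _ _⟩

lemma cover_map (hG : ∀ n, ⊤ ≤ ⨆ k, LinearMap.range (G.x k n))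
    (hp : Submodule.span R (Set.range p) = ⊤) (n : ℕ) :
    ((free R σ ι).P n).map (G.cover p) = G.P n := by
  induction n with
  | zero =>
    apply le_antisymm
    · rintro _ ⟨f, hf, rfl⟩
      rw [cover_apply]
      refine sum_mem fun i _ => ?_
      have h1 : f i ∈ MvPolynomial.homogeneousSubmodule σ R 0 := hf i trivial
      rw [MvPolynomial.homogeneousSubmodule_zero, Submodule.mem_one] at h1
      obtain ⟨r, hr⟩ := h1
      rw [← hr, AlgHom.commutes]
      exact Submodule.smul_mem _ r (p i).2
    · have h1 : ⊤ ≤ (((free R σ ι).P 0).map (G.cover p)).comap (G.P 0).subtype := by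
        rw [← hp, Submodule.span_le]
        rintro _ ⟨i, rfl⟩
        classical
        refine ⟨Pi.single i 1, fun l _ => ?_, ?_⟩
        · by_cases hl : l = i
          · subst hl
            rw [Pi.single_eq_same]
            exact MvPolynomial.isHomogeneous_one σ R
          · simp [Pi.single_eq_of_ne hl]
        · rw [cover_apply, Finset.sum_eq_single i]
          · simp
          · intro l _ hl
            simp [Pi.single_eq_of_ne hl]
          · simp
      intro y hy
      exact h1 (x := ⟨y, hy⟩) trivial
  | succ n ih => exact G.cover_map_succ p n (hG n) ih

/-- The kernel of the covering map. -/
noncomputable abbrev syz : GrMod R σ where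
  A := (free R σ ι).A
  ρ := (free R σ ι).ρ
  P n := (free R σ ι).P n ⊓ LinearMap.ker (G.cover p)
  stable k n y hy := by
    have h : G.cover p y = 0 := hy.2
    exact ⟨(free R σ ι).stable k n hy.1, LinearMap.mem_ker.2
      ((G.cover_smul p _ y).trans (by rw [h, map_zero]))⟩

lemma syz_EFG [Finite σ] [IsNoetherianRing R] : (G.syz p).EFG where
  finite n := by
    have := free_finite (R := R) (σ := σ) ι n
    exact Module.Finite.of_injective
      (Submodule.inclusion (inf_le_left : (G.syz p).P n ≤ (free R σ ι).P n))
      (Submodule.inclusion_injective _)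
  gen := by
    have hW : (free R σ ι).toFam.Stable fun n _ =>
        ((G.syz p).P n).submoduleOf ((free R σ ι).P n) :=
      ⟨fun k n _ y hy => (G.syz p).stable k n hy, fun _ _ _ _ hy => hy⟩
    obtain ⟨N, hN⟩ := (free_EFG ι).toFam.exists_stable_X hW
    refine ⟨N, fun n hn => (top_le_iff_P_le _ n).2 fun y hy => ?_⟩
    have h1 := hN n hn N le_rfl (x := ⟨y, hy.1⟩) hy
    have h2 : (⨆ k, (((G.syz p).P n).submoduleOf ((free R σ ι).P n)).map
        ((free R σ ι).toFam.X k n N)) ≤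
        (⨆ k, ((G.syz p).P n).map ((G.syz p).ρ (MvPolynomial.X k))).comap
          ((free R σ ι).P (n + 1)).subtype := by
      refine iSup_le fun k => ?_
      rintro _ ⟨z, hz, rfl⟩
      exact Submodule.mem_iSup_of_mem k ⟨z.1, hz, rfl⟩
    exact h2 h1

end cover

end GrMod

end TorAux

namespace TorAux

variable {R : Type} [CommRing R] {σ τ : Type}

lemma Fam.EFG.of_injective [Finite σ] [Finite τ] [IsNoetherianRing R] {F G : Fam R σ τ}
    (h : F.EFG) (φ : ∀ n m, G.E n m →ₗ[R] F.E n m) (hφ : ∀ n m, Function.Injective (φ n m))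
    (hX : ∀ k n m x, φ (n + 1) m (G.X k n m x) = F.X k n m (φ n m x))
    (hY : ∀ k n m x, φ n (m + 1) (G.Y k n m x) = F.Y k n m (φ n m x)) : G.EFG := by
  have hW : F.Stable fun n m => LinearMap.range (φ n m) := by
    refine ⟨fun k n m => ?_, fun k n m => ?_⟩
    · rintro _ ⟨x, rfl⟩
      exact ⟨_, hX k n m x⟩
    · rintro _ ⟨x, rfl⟩
      exact ⟨_, hY k n m x⟩
  have e : ∀ n m, ∀ x, LinearEquiv.ofInjective (φ n m) (hφ n m) x = ⟨φ n m x, ⟨x, rfl⟩⟩ :=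
    fun n m x => rfl
  refine (h.sub hW).of_surjective' (G := G)
    (fun n m => (LinearEquiv.ofInjective (φ n m) (hφ n m)).symm.toLinearMap)
    (fun n m => (LinearEquiv.ofInjective (φ n m) (hφ n m)).symm.surjective) ?_ ?_
  · rintro k n m ⟨_, x, rfl⟩
    refine (LinearEquiv.symm_apply_eq _).2 ?_
    have := (LinearEquiv.ofInjective (φ n m) (hφ n m)).symm_apply_apply x
    rw [e] at this
    refine Subtype.ext ?_
    exact (hX k n m x).symm.trans (congrArg (fun y => φ (n + 1) m (G.X k n m y)) this.symm)
  · rintro k n m ⟨_, x, rfl⟩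
    refine (LinearEquiv.symm_apply_eq _).2 ?_
    have := (LinearEquiv.ofInjective (φ n m) (hφ n m)).symm_apply_apply x
    rw [e] at this
    refine Subtype.ext ?_
    exact (hY k n m x).symm.trans (congrArg (fun y => φ n (m + 1) (G.Y k n m y)) this.symm)

namespace GrMod

section

variable (G : GrMod R σ) {ι : Type} [Fintype ι] (p : ι → G.P 0)
  (hG : ∀ n, ⊤ ≤ ⨆ k, LinearMap.range (G.x k n)) (hp : Submodule.span R (Set.range p) = ⊤)

/-- The inclusion of the syzygies. -/
noncomputable def syzIncl (n : ℕ) : (G.syz p).P n →ₗ[R] (free R σ ι).P n :=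
  Submodule.inclusion inf_le_left

lemma syzIncl_injective (n : ℕ) : Function.Injective (G.syzIncl p n) :=
  Submodule.inclusion_injective _

/-- The covering map in each degree. -/
noncomputable def coverAt (n : ℕ) : (free R σ ι).P n →ₗ[R] G.P n :=
  (G.cover p).restrict fun _ hx => G.cover_map p hG hp n ▸ Submodule.mem_map_of_mem hx

lemma coverAt_surjective (n : ℕ) : Function.Surjective (G.coverAt p hG hp n) := by
  rintro ⟨y, hy⟩
  obtain ⟨z, hz, rfl⟩ := (G.cover_map p hG hp n).ge hy
  exact ⟨⟨z, hz⟩, rfl⟩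

lemma coverAt_exact (n : ℕ) : Function.Exact (G.syzIncl p n) (G.coverAt p hG hp n) := by
  rintro ⟨y, hy⟩
  constructor
  · intro h
    exact ⟨⟨y, hy, congrArg Subtype.val h⟩, rfl⟩
  · rintro ⟨⟨z, hz, hz'⟩, h⟩
    obtain rfl : z = y := congrArg Subtype.val h
    exact Subtype.ext hz'

end

lemma EFG.of_shift {G : GrMod R σ} {H : GrMod R τ} {j N : ℕ} (h : (torFam j (G.shift N) H).EFG)
    (hG : ∀ n, Module.Finite R (G.P n)) (hH : ∀ n, Module.Finite R (H.P n))
    [IsNoetherianRing R] : (torFam j G H).EFG where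
  finite n m := by
    have := hG n
    have := hH m
    exact inferInstanceAs (Module.Finite R (T R j (G.P n) (H.P m)))
  gen := by
    obtain ⟨N', hN'⟩ := h.gen
    refine ⟨N + N', fun n hn m hm => ?_⟩
    obtain ⟨n, rfl⟩ := Nat.exists_eq_add_of_le (show N ≤ n by omega)
    exact hN' n (by omega) m (by omega)

theorem torFam_EFG [Finite σ] [Finite τ] [IsNoetherianRing R] (j : ℕ) (G : GrMod R σ)
    (H : GrMod R τ) (hG : G.EFG) (hH : H.EFG) : (torFam j G H).EFG := by
  induction j generalizing G with
  | zero =>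
    obtain ⟨N, hN⟩ := hG.gen
    obtain ⟨N', hN'⟩ := hH.gen
    have := hG.finite
    have := hH.finite
    exact ⟨fun n m => inferInstanceAs (Module.Finite R (T R 0 (G.P n) (H.P m))),
      N + N', fun n hn m hm => ⟨T.zero_range_left (hN n (by omega)),
        T.zero_range_right (hN' m (by omega))⟩⟩
  | succ j ih =>
    obtain ⟨N, hN⟩ := hG.gen
    refine EFG.of_shift (N := N) ?_ hG.finite hH.finite
    have hN' : ∀ n, ⊤ ≤ ⨆ k, LinearMap.range ((G.shift N).x k n) :=
      fun n => hN _ (Nat.le_add_right N n)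
    have : Module.Finite R ((G.shift N).P 0) := hG.finite _
    generalize G.shift N = G at *
    obtain ⟨r, p, hp⟩ := Module.Finite.exists_fin (R := R) (M := G.P 0)
    have hfl := fun n => free_flat (R := R) (σ := σ) (Fin r) n
    refine (ih (G.syz p) (G.syz_EFG p)).of_injective (fun n m =>
      T.δ j (G.coverAt_exact p hN' hp n) (G.syzIncl_injective p n)
        (G.coverAt_surjective p hN' hp n) (H.P m)) (fun n m => T.δ_injective _ _ _ _) ?_ ?_
    · intro k n m t
      exact (LinearMap.congr_fun (T.δ_naturality j (G.coverAt_exact p hN' hp n)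
        (G.syzIncl_injective p n) (G.coverAt_surjective p hN' hp n)
        (G.coverAt_exact p hN' hp (n + 1)) (G.syzIncl_injective p (n + 1))
        (G.coverAt_surjective p hN' hp (n + 1)) ((G.syz p).x k n) ((free R σ (Fin r)).x k n)
        (G.x k n) rfl (LinearMap.ext fun y => Subtype.ext (G.cover_smul p _ y.1))
        LinearMap.id) t).symm
    · intro k n m t
      exact (T.δ_natural_right j _ _ _ _ t).symm

end GrMod

end TorAux

namespace TorAux

section FiniteLength

variable {R : Type} [CommRing R] [IsNoetherianRing R] [IsLocalRing R]

lemma isFiniteLength_of_pow_le_annihilator {X : Type} [AddCommGroup X] [Module R X]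
    [Module.Finite R X] (k : ℕ) (h : maximalIdeal R ^ k ≤ Module.annihilator R X) :
    IsFiniteLength R X := by
  rw [isFiniteLength_iff_isNoetherian_isArtinian]
  refine ⟨inferInstance, ?_⟩
  by_cases hI : Module.annihilator R X = ⊤
  · have : Subsingleton X := Module.annihilator_eq_top_iff.1 hI
    infer_instance
  have : Nontrivial (R ⧸ Module.annihilator R X) := Ideal.Quotient.nontrivial_iff.mpr hI
  have := IsLocalRing.of_surjective' (Ideal.Quotient.mk (Module.annihilator R X))
    Ideal.Quotient.mk_surjective
  have := IsLocalHom.of_surjective (Ideal.Quotient.mk (Module.annihilator R X))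
    Ideal.Quotient.mk_surjective
  have hm : (maximalIdeal R).map (Ideal.Quotient.mk (Module.annihilator R X)) =
      maximalIdeal (R ⧸ Module.annihilator R X) := by
    ext x
    obtain ⟨x, rfl⟩ := Ideal.Quotient.mk_surjective x
    simp [sup_eq_left.mpr (le_maximalIdeal hI)]
  have : IsArtinianRing (R ⧸ Module.annihilator R X) := by
    rw [isArtinianRing_iff_isNilpotent_maximalIdeal]
    refine ⟨k, ?_⟩
    rw [← hm, ← Ideal.map_pow, Ideal.zero_eq_bot, Ideal.map_eq_bot_iff_le_ker, Ideal.mk_ker]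
    exact h
  let : Module (R ⧸ Module.annihilator R X) X :=
    Module.IsTorsionBySet.module (Module.isTorsionBySet_annihilator R X)
  have : IsScalarTower R (R ⧸ Module.annihilator R X) X :=
    Module.IsTorsionBySet.isScalarTower (Module.isTorsionBySet_annihilator R X)
  have : Module.Finite (R ⧸ Module.annihilator R X) X :=
    Module.Finite.of_restrictScalars_finite R _ X
  exact isArtinian_of_surjective_algebraMap (R := R ⧸ Module.annihilator R X)
    Ideal.Quotient.mk_surjective

omit [IsNoetherianRing R] in
/-- A module of finite length over a local ring is annihilated by a power of the maximal ideal. -/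
lemma exists_pow_smul_eq_zero {X : Type} [AddCommGroup X] [Module R X]
    (h : IsFiniteLength R X) : ∃ k, ∀ r ∈ maximalIdeal R ^ k, ∀ x : X, r • x = 0 := by
  rw [isFiniteLength_iff_isNoetherian_isArtinian] at h
  obtain ⟨h1, h2⟩ := h
  obtain ⟨k, hk⟩ := IsArtinian.monotone_stabilizes (R := R) (M := X)
    ⟨fun k => OrderDual.toDual (maximalIdeal R ^ k • (⊤ : Submodule R X)), fun a b hab =>
      Submodule.smul_mono_left (Ideal.pow_le_pow_right hab)⟩
  have hk1 : maximalIdeal R ^ k • (⊤ : Submodule R X) = maximalIdeal R ^ (k + 1) • ⊤ :=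
    hk (k + 1) (by omega)
  have : maximalIdeal R ^ k • (⊤ : Submodule R X) = ⊥ := by
    refine Submodule.eq_bot_of_le_smul_of_le_jacobson_bot (maximalIdeal R) _
      (IsNoetherian.noetherian _) ?_ (maximalIdeal_le_jacobson _)
    rw [← Submodule.mul_smul, ← pow_succ', ← hk1]
  refine ⟨k, fun r hr x => ?_⟩
  have h3 := Submodule.smul_mem_smul hr (Submodule.mem_top (x := x))
  rwa [this] at h3

/-- The ideal `I` cuts out modules of finite length among the modules annihilated by `Q`. -/
def Cuts (I Q : Ideal R) : Prop := (I ⊔ Q).radical = maximalIdeal R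

variable {I Q : Ideal R}

omit [IsNoetherianRing R] in
lemma Cuts.le_maximalIdeal (h : Cuts I Q) : I ≤ maximalIdeal R :=
  le_sup_left.trans (Ideal.le_radical.trans h.le)

lemma Cuts.isFiniteLength (h : Cuts I Q) (n : ℕ) {X : Type} [AddCommGroup X] [Module R X]
    [Module.Finite R X] (hI : I ^ n ≤ Module.annihilator R X)
    (hQ : Q ≤ Module.annihilator R X) : IsFiniteLength R X := by
  obtain ⟨k, hk⟩ := Ideal.exists_radical_pow_le_of_fg (I ⊔ Q) (IsNoetherian.noetherian _)
  rw [h] at hk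
  refine isFiniteLength_of_pow_le_annihilator (k * (n + 1)) ?_
  rw [pow_mul]
  refine (Ideal.pow_right_mono hk (n + 1)).trans (Ideal.sup_pow_add_le_pow_sup_pow.trans ?_)
  rw [pow_one]
  exact sup_le hI hQ

end FiniteLength

section annihilator

variable {R : Type} [CommRing R] {P Q : Type} [AddCommGroup P] [Module R P]
  [AddCommGroup Q] [Module R Q]

lemma T.annihilator_left (j : ℕ) :
    Module.annihilator R P ≤ Module.annihilator R (T R j P Q) := fun r hr => by
  rw [Module.mem_annihilator] at hr ⊢
  exact T.smul_eq_zero_left j hr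

lemma T.annihilator_right (j : ℕ) :
    Module.annihilator R Q ≤ Module.annihilator R (T R j P Q) := fun r hr => by
  rw [Module.mem_annihilator] at hr ⊢
  exact T.smul_eq_zero_right j hr

end annihilator

/-- The filtration of a module by the powers of an ideal, with its action of the Rees algebra. -/
noncomputable abbrev powGr {R : Type} [CommRing R] {σ : Type} (x : σ → R)
    (M : Type) [AddCommGroup M] [Module R M] : GrMod R σ where
  A := M
  ρ := (Algebra.ofId R (Module.End R M)).comp (MvPolynomial.aeval x)
  P n := Ideal.span (Set.range x) ^ n • ⊤
  stable k n p hp := by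
    have : ((Algebra.ofId R (Module.End R M)).comp (MvPolynomial.aeval x))
        (MvPolynomial.X k) p = x k • p := by
      simp [Algebra.ofId_apply]
    rw [Submodule.mem_comap, this, pow_succ', Submodule.mul_smul]
    exact Submodule.smul_mem_smul (Ideal.subset_span ⟨k, rfl⟩) hp

section powGr

variable {R : Type} [CommRing R] {σ : Type} (x : σ → R)
    (M : Type) [AddCommGroup M] [Module R M]

lemma powGr_ρ (k : σ) (p : M) : (powGr x M).ρ (MvPolynomial.X k) p = x k • p := by
  change ((Algebra.ofId R (Module.End R M)).comp (MvPolynomial.aeval x))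
    (MvPolynomial.X k) p = x k • p
  simp [Algebra.ofId_apply]

lemma powGr_x (k : σ) (n : ℕ) (p : (powGr x M).P n) :
    ((powGr x M).x k n p : M) = x k • (p : M) :=
  powGr_ρ x M k p

lemma powGr_EFG [IsNoetherianRing R] [Module.Finite R M] : (powGr x M).EFG where
  finite n := by
    have : IsNoetherian R (powGr x M).A := inferInstanceAs (IsNoetherian R M)
    infer_instance
  gen := by
    refine ⟨0, fun n _ => ((powGr x M).top_le_iff_P_le n).2 ?_⟩
    change Ideal.span (Set.range x) ^ (n + 1) • (⊤ : Submodule R M) ≤ _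
    rw [pow_succ', Submodule.mul_smul]
    refine Submodule.smul_le.2 ?_
    intro r hr p hp
    induction hr using Submodule.span_induction with
    | mem r hr =>
      obtain ⟨k, rfl⟩ := hr
      exact Submodule.mem_iSup_of_mem k ⟨p, hp, powGr_ρ x M k p⟩
    | zero =>
      rw [zero_smul]
      exact zero_mem _
    | add r s _ _ hr hs =>
      rw [add_smul]
      exact add_mem hr hs
    | smul c r _ hr =>
      rw [smul_assoc]
      exact Submodule.smul_mem _ c hr

end powGr

end TorAux

namespace TorAux

variable {R : Type} [CommRing R]

lemma T.map_surjective {P P' Q Q' : Type} [AddCommGroup P] [Module R P] [AddCommGroup P']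
    [Module R P'] [AddCommGroup Q] [Module R Q] [AddCommGroup Q'] [Module R Q'] (j : ℕ)
    {f : P →ₗ[R] P'} {f' : P' →ₗ[R] P} {g : Q →ₗ[R] Q'} {g' : Q' →ₗ[R] Q}
    (hf : f ∘ₗ f' = LinearMap.id) (hg : g ∘ₗ g' = LinearMap.id) :
    Function.Surjective (T.map j f g) := by
  intro v
  have h := T.map_comp j f' f g' g
  rw [hf, hg, T.map_id] at h
  exact ⟨_, (LinearMap.congr_fun h v).symm⟩

/-- A constant sequence of modules. -/
noncomputable abbrev GrMod.const (M : Type) [AddCommGroup M] [Module R M] : GrMod R Unit where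
  A := M
  ρ := (Algebra.ofId R (Module.End R M)).comp (MvPolynomial.aeval fun _ => 1)
  P _ := ⊤
  stable _ _ _ _ := trivial

section const

variable (M : Type) [AddCommGroup M] [Module R M]

lemma GrMod.const_x (k : Unit) (n : ℕ) (p : (GrMod.const (R := R) M).P n) :
    (((GrMod.const (R := R) M).x k n p : (⊤ : Submodule R M)) : M) =
      ((p : (⊤ : Submodule R M)) : M) := by
  change ((Algebra.ofId R (Module.End R M)).comp (MvPolynomial.aeval fun _ => 1))
    (MvPolynomial.X k) (p : M) = (p : M)
  simp

lemma GrMod.const_EFG [IsNoetherianRing R] [Module.Finite R M] :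
    (GrMod.const (R := R) M).EFG where
  finite n := by
    have : IsNoetherian R (GrMod.const (R := R) M).A := inferInstanceAs (IsNoetherian R M)
    infer_instance
  gen := ⟨0, fun n _ p _ => Submodule.mem_iSup_of_mem ()
    ⟨p, Subtype.ext (GrMod.const_x M () n p)⟩⟩

end const

/-- The powers of an ideal times a module. -/
abbrev pw {σ : Type} (x : σ → R) (M : Type) [AddCommGroup M] [Module R M] (n : ℕ) :
    Submodule R M :=
  Ideal.span (Set.range x) ^ n • ⊤

lemma pw_succ_le {σ : Type} (x : σ → R) (M : Type) [AddCommGroup M] [Module R M] (n : ℕ) :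
    pw x M (n + 1) ≤ pw x M n :=
  Submodule.smul_mono_left (Ideal.pow_le_pow_right (Nat.le_succ n))

lemma pw_le_annihilator {σ : Type} (x : σ → R) (M : Type) [AddCommGroup M] [Module R M] (n : ℕ) :
    Ideal.span (Set.range x) ^ n ≤ Module.annihilator R (M ⧸ pw x M n) := fun r hr => by
  rw [Module.mem_annihilator]
  intro p
  obtain ⟨p, rfl⟩ := Submodule.Quotient.mk_surjective _ p
  rw [← Submodule.Quotient.mk_smul, Submodule.Quotient.mk_eq_zero]
  exact Submodule.smul_mem_smul hr trivial

section

variable {σ τ : Type} (x : σ → R) (M : Type) [AddCommGroup M] [Module R M] (j : ℕ)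
  (H : GrMod R τ)

/-- The map induced on `Tor` by the projection `M → M / I ^ n M`. -/
noncomputable abbrev pr (n : ℕ) (Q : Type) [AddCommGroup Q] [Module R Q] :
    T R j M Q →ₗ[R] T R j (M ⧸ pw x M n) Q :=
  T.map j (pw x M n).mkQ LinearMap.id

/-- The map induced on `Tor` by the inclusion `I ^ n M → M`. -/
noncomputable abbrev inc (n : ℕ) (Q : Type) [AddCommGroup Q] [Module R Q] :
    T R j (pw x M n) Q →ₗ[R] T R j M Q :=
  T.map j (pw x M n).subtype LinearMap.id

/-- The maps `inc` on the family of `Tor` modules. -/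
noncomputable abbrev incF (n m : ℕ) :
    (GrMod.torFam j (powGr x M) H).E n m →ₗ[R] T R j M (H.P m) :=
  inc x M j n (H.P m)

lemma inc_X (k : σ) (n m : ℕ) (e : (GrMod.torFam j (powGr x M) H).E n m) :
    incF x M j H (n + 1) m ((GrMod.torFam j (powGr x M) H).X k n m e) =
      x k • incF x M j H n m e := by
  have h1 : (pw x M (n + 1)).subtype ∘ₗ (powGr x M).x k n = x k • (pw x M n).subtype :=
    LinearMap.ext fun p => powGr_x x M k n p
  have h2 := T.map_comp j ((powGr x M).x k n) (pw x M (n + 1)).subtype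
    (LinearMap.id : H.P m →ₗ[R] H.P m) LinearMap.id
  rw [h1, LinearMap.comp_id, T.map_smul_left] at h2
  exact (LinearMap.congr_fun h2 e).symm

lemma inc_Y (l : τ) (n m : ℕ) (e : (GrMod.torFam j (powGr x M) H).E n m) :
    incF x M j H n (m + 1) ((GrMod.torFam j (powGr x M) H).Y l n m e) =
      T.map j LinearMap.id (H.x l m) (incF x M j H n m e) :=
  (T.map_comm j _ _ e).symm

lemma ker_incF_stable : (GrMod.torFam j (powGr x M) H).Stable fun n m =>
    LinearMap.ker (incF x M j H n m) := by
  refine ⟨fun k n m e he => ?_, fun k n m e he => ?_⟩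
  · rw [Submodule.mem_comap, LinearMap.mem_ker, inc_X, he, smul_zero]
  · rw [Submodule.mem_comap, LinearMap.mem_ker, inc_Y, he, map_zero]

/-- The connecting homomorphisms for `0 → I ^ n M → M → M / I ^ n M → 0`. -/
noncomputable abbrev dl (n : ℕ) (Q : Type) [AddCommGroup Q] [Module R Q] :
    T R (j + 1) (M ⧸ pw x M n) Q →ₗ[R] T R j (pw x M n) Q :=
  T.δ j (LinearMap.exact_subtype_mkQ (pw x M n)) (Submodule.injective_subtype _)
    (Submodule.mkQ_surjective _) Q

lemma exact_pr_dl (n : ℕ) (Q : Type) [AddCommGroup Q] [Module R Q] :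
    Function.Exact (pr x M (j + 1) n Q) (dl x M j n Q) :=
  T.exact₃ j _ _ _

lemma exact_dl_inc (n : ℕ) (Q : Type) [AddCommGroup Q] [Module R Q] :
    Function.Exact (dl x M j n Q) (inc x M j n Q) :=
  T.exact₁ j _ _ _

variable {M} in
lemma exact_inc_pr (n : ℕ) (Q : Type) [AddCommGroup Q] [Module R Q] :
    Function.Exact (inc x M j n Q) (pr x M j n Q) :=
  T.exact₂ j (LinearMap.exact_subtype_mkQ _) (Submodule.injective_subtype _)
    (Submodule.mkQ_surjective _)

lemma ker_pr_anti (n : ℕ) (Q : Type) [AddCommGroup Q] [Module R Q] :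
    LinearMap.ker (pr x M j (n + 1) Q) ≤ LinearMap.ker (pr x M j n Q) := fun v hv => by
  have h := T.map_comp j (pw x M (n + 1)).mkQ (Submodule.factor (pw_succ_le x M n))
    (LinearMap.id : Q →ₗ[R] Q) LinearMap.id
  rw [Submodule.factor_comp_mk, LinearMap.comp_id] at h
  rw [LinearMap.mem_ker] at hv ⊢
  rw [pr, h, LinearMap.comp_apply, hv, map_zero]

end

section length

variable [IsNoetherianRing R] [IsLocalRing R] {σ τ : Type} {x : σ → R} {M : Type}
  [AddCommGroup M] [Module R M] [Module.Finite R M] {H : GrMod R τ} {Q : Ideal R}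

lemma isFiniteLength_T (hI : Cuts (Ideal.span (Set.range x)) Q) (j n : ℕ)
    {B : Type} [AddCommGroup B] [Module R B] [Module.Finite R B]
    (hQ : Q ≤ Module.annihilator R M ⊔ Module.annihilator R B) :
    IsFiniteLength R (T R j (M ⧸ pw x M n) B) := by
  have := T.finite (R := R) (P := M ⧸ pw x M n) (Q := B) j
  refine hI.isFiniteLength n ((pw_le_annihilator x M n).trans (T.annihilator_left j))
    (hQ.trans (sup_le ?_ (T.annihilator_right j)))
  exact (LinearMap.annihilator_le_of_surjective _ (pw x M n).mkQ_surjective).trans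
    (T.annihilator_left j)

lemma evPoly_pr_const (hI : Cuts (Ideal.span (Set.range x)) Q) (hH : H.EFG)
    [Finite τ] (hQ : ∀ m, Q ≤ Module.annihilator R M ⊔ Module.annihilator R (H.P m)) (j n₀ : ℕ) :
    EvPoly fun _ m => len R (LinearMap.range (pr x M j n₀ (H.P m))) := by
  have := hH.finite
  let F := GrMod.torFam j (GrMod.const M) H
  let ψ : ∀ n m, F.E n m →ₗ[R] T R j (M ⧸ pw x M n₀) (H.P m) := fun n m =>
    T.map j ((pw x M n₀).mkQ ∘ₗ (⊤ : Submodule R M).subtype) LinearMap.id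
  have hF : F.EFG := GrMod.torFam_EFG j _ _ (GrMod.const_EFG M) hH
  have hψX : ∀ k n m e, ψ (n + 1) m (F.X k n m e) = ψ n m e := fun k n m e => by
    have h1 : ((pw x M n₀).mkQ ∘ₗ (⊤ : Submodule R M).subtype) ∘ₗ (GrMod.const M).x k n =
        (pw x M n₀).mkQ ∘ₗ (⊤ : Submodule R M).subtype :=
      LinearMap.ext fun p => congrArg (pw x M n₀).mkQ (GrMod.const_x M k n p)
    have h2 := T.map_comp j ((GrMod.const M).x k n)
      ((pw x M n₀).mkQ ∘ₗ (⊤ : Submodule R M).subtype)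
      (LinearMap.id : H.P m →ₗ[R] H.P m) LinearMap.id
    rw [h1, LinearMap.comp_id] at h2
    exact (LinearMap.congr_fun h2 e).symm
  have hψY : ∀ k n m e, ψ n (m + 1) (F.Y k n m e) = T.map j LinearMap.id (H.x k m) (ψ n m e) :=
    fun k n m e => (T.map_comm j _ _ e).symm
  have hK : F.Stable fun n m => LinearMap.ker (ψ n m) := by
    refine ⟨fun k n m e he => ?_, fun k n m e he => ?_⟩
    · rw [Submodule.mem_comap, LinearMap.mem_ker, hψX, he]
    · rw [Submodule.mem_comap, LinearMap.mem_ker, hψY, he, map_zero]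
  have hr : ∀ n m, LinearMap.range (ψ n m) = LinearMap.range (pr x M j n₀ (H.P m)) := by
    intro n m
    have h2 := T.map_comp j (⊤ : Submodule R M).subtype (pw x M n₀).mkQ
      (LinearMap.id : H.P m →ₗ[R] H.P m) LinearMap.id
    have h3 : Function.Surjective (T.map j (⊤ : Submodule R M).subtype
        (LinearMap.id : H.P m →ₗ[R] H.P m)) :=
      T.map_surjective j (f' := (Submodule.topEquiv (R := R) (M := M)).symm.toLinearMap)
        (g' := LinearMap.id) rfl rfl
    change LinearMap.range (T.map j ((pw x M n₀).mkQ ∘ₗ (⊤ : Submodule R M).subtype)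
      LinearMap.id) = _
    rw [LinearMap.comp_id] at h2
    rw [h2, LinearMap.range_comp_of_range_eq_top _ (LinearMap.range_eq_top.2 h3)]
  refine ((hF.quot hK).evPoly fun n m => ?_).congr 0 fun n _ m _ => ?_
  · exact ((isFiniteLength_T hI j n₀ (hQ m)).of_injective (Submodule.injective_subtype
      (LinearMap.range (ψ n m)))).of_injective
      (ψ n m).quotKerEquivRange.injective
  · rw [← hr n m]
    exact len_congr (ψ n m).quotKerEquivRange.symm

lemma evPoly_pr (hI : Cuts (Ideal.span (Set.range x)) Q) (hH : H.EFG)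
    [Finite σ] [Finite τ]
    (hQ : ∀ m, Q ≤ Module.annihilator R M ⊔ Module.annihilator R (H.P m)) (j : ℕ) :
    EvPoly fun n m => len R (LinearMap.range (pr x M j n (H.P m))) := by
  have := hH.finite
  refine EvPoly.of_difference ?_ ⟨0, fun n₀ _ => evPoly_pr_const hI hH hQ j n₀⟩
  let F := GrMod.torFam j (powGr x M) H
  have hF : F.EFG := GrMod.torFam_EFG j _ _ (powGr_EFG x M) hH
  let φ : ∀ n m, F.E n m →ₗ[R] T R j M (H.P m) := incF x M j H
  have hφX : ∀ k n m e, φ (n + 1) m (F.X k n m e) = x k • φ n m e := inc_X x M j H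
  have hφY : ∀ l n m e, φ n (m + 1) (F.Y l n m e) = T.map j LinearMap.id (H.x l m) (φ n m e) :=
    inc_Y x M j H
  have hex : ∀ n m, LinearMap.ker (pr x M j n (H.P m)) = LinearMap.range (φ n m) :=
    fun n m => (exact_inc_pr x j n (H.P m)).linearMap_ker_eq
  have hL : F.Stable fun n m => (LinearMap.range (φ (n + 1) m)).comap (φ n m) := by
    refine ⟨?_, ?_⟩
    · rintro k n m e ⟨e', he⟩
      exact ⟨F.X k _ _ e', by rw [hφX, hφX, he]⟩
    · rintro k n m e ⟨e', he⟩
      exact ⟨F.Y k _ _ e', by rw [hφY, hφY, he]⟩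
  have hfl : ∀ n m, IsFiniteLength R (T R j M (H.P m) ⧸ LinearMap.range (φ n m)) := by
    intro n m
    rw [← hex]
    exact ((isFiniteLength_T hI j n (hQ m)).of_injective (Submodule.injective_subtype
      (LinearMap.range (pr x M j n (H.P m))))).of_injective
      (pr x M j n (H.P m)).quotKerEquivRange.injective
  have hlen : ∀ n m, len R (LinearMap.range (pr x M j n (H.P m))) =
      len R (T R j M (H.P m) ⧸ LinearMap.range (φ n m)) := by
    intro n m
    rw [← hex]
    exact len_congr (pr x M j n (H.P m)).quotKerEquivRange.symm
  have hle : ∀ n m, LinearMap.range (φ (n + 1) m) ≤ LinearMap.range (φ n m) := by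
    intro n m
    rw [← hex, ← hex]
    exact ker_pr_anti x M j n (H.P m)
  let α : ∀ n m, (F.E n m ⧸ (LinearMap.range (φ (n + 1) m)).comap (φ n m)) →ₗ[R]
      (T R j M (H.P m) ⧸ LinearMap.range (φ (n + 1) m)) := fun n m =>
    Submodule.mapQ _ _ (φ n m) le_rfl
  have hα : ∀ n m, Function.Injective (α n m) := by
    intro n m
    rw [← LinearMap.ker_eq_bot, LinearMap.ker_eq_bot']
    intro e he
    obtain ⟨e, rfl⟩ := Submodule.Quotient.mk_surjective _ e
    rw [Submodule.mapQ_apply, Submodule.Quotient.mk_eq_zero] at he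
    exact (Submodule.Quotient.mk_eq_zero _).2 he
  refine ((hF.quot hL).evPoly fun n m => (hfl (n + 1) m).of_injective (hα n m)).congr 0
    fun n _ m _ => ?_
  have := len_of_exact (hα n m) (Submodule.factor_surjective (hle n m)) (fun v => ?_)
    (hfl (n + 1) m)
  · rw [hlen, hlen, this, add_sub_cancel_right]
    rfl
  · obtain ⟨v, rfl⟩ := Submodule.Quotient.mk_surjective _ v
    constructor
    · intro h
      have h1 : (Submodule.Quotient.mk v : T R j M (H.P m) ⧸ LinearMap.range (φ n m)) = 0 := h
      rw [Submodule.Quotient.mk_eq_zero] at h1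
      obtain ⟨e, rfl⟩ := h1
      exact ⟨Submodule.Quotient.mk e, rfl⟩
    · rintro ⟨e, he⟩
      obtain ⟨e, rfl⟩ := Submodule.Quotient.mk_surjective _ e
      rw [← he]
      exact (Submodule.Quotient.mk_eq_zero _).2 ⟨e, rfl⟩

lemma isFiniteLength_ker_incF (hI : Cuts (Ideal.span (Set.range x)) Q) (hH : H.EFG)
    (hQ : ∀ m, Q ≤ Module.annihilator R M ⊔ Module.annihilator R (H.P m)) (j n m : ℕ) :
    IsFiniteLength R (LinearMap.ker (incF x M j H n m)) := by
  have := hH.finite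
  have h1 := (isFiniteLength_T hI (j + 1) n (hQ m)).of_surjective
    (dl x M j n (H.P m)).surjective_rangeRestrict
  exact h1.of_injective (LinearEquiv.ofEq _ _
    (exact_dl_inc x M j n (H.P m)).linearMap_ker_eq).injective

lemma evPoly_quotient (hI : Cuts (Ideal.span (Set.range x)) Q) (hH : H.EFG)
    [Finite σ] [Finite τ]
    (hQ : ∀ m, Q ≤ Module.annihilator R M ⊔ Module.annihilator R (H.P m)) (j : ℕ) :
    EvPoly fun n m => len R (T R j (M ⧸ pw x M n) (H.P m)) := by
  have := hH.finite
  cases j with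
  | zero =>
    refine (evPoly_pr hI hH hQ 0).congr 0 fun n _ m _ => ?_
    rw [LinearMap.range_eq_top.2 (T.zero_map_left_surjective (pw x M n).mkQ_surjective)]
    exact (len_congr Submodule.topEquiv).symm
  | succ j =>
    have hF : (GrMod.torFam j (powGr x M) H).EFG :=
      GrMod.torFam_EFG j _ _ (powGr_EFG x M) hH
    refine ((evPoly_pr hI hH hQ (j + 1)).add ((hF.sub (ker_incF_stable x M j H)).evPoly
      fun n m => isFiniteLength_ker_incF hI hH hQ j n m)).congr 0 fun n _ m _ => ?_
    have h1 := len_ker_range (dl x M j n (H.P m)) (isFiniteLength_T hI (j + 1) n (hQ m))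
    rw [(exact_pr_dl x M j n (H.P m)).linearMap_ker_eq] at h1
    have h2 := (exact_dl_inc x M j n (H.P m)).linearMap_ker_eq
    exact h1.trans (congrArg _ (len_congr (LinearEquiv.ofEq _ _ h2.symm)))

end length

end TorAux

namespace TorAux

variable {R : Type} [CommRing R]

section linear

variable {A B C D : Type} [AddCommGroup A] [Module R A] [AddCommGroup B] [Module R B]
  [AddCommGroup C] [Module R C] [AddCommGroup D] [Module R D]

lemma len_quotient_sup_ker (f : A →ₗ[R] B) (W : Submodule R A)
    (hf : IsFiniteLength R (LinearMap.range f)) :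
    len R (A ⧸ (W ⊔ LinearMap.ker f)) = len R (LinearMap.range f) - len R (W.map f) := by
  have h1 : W.map f ≤ LinearMap.range f := LinearMap.map_le_range
  let g : A →ₗ[R] LinearMap.range f ⧸ LinearMap.range (Submodule.inclusion h1) :=
    (LinearMap.range (Submodule.inclusion h1)).mkQ ∘ₗ f.rangeRestrict
  have hg : Function.Surjective g :=
    (Submodule.mkQ_surjective _).comp f.surjective_rangeRestrict
  have hk : LinearMap.ker g = W ⊔ LinearMap.ker f := by
    rw [← Submodule.comap_map_eq]
    ext a
    change Submodule.Quotient.mk (f.rangeRestrict a) = (0 : LinearMap.range f ⧸ _) ↔ f a ∈ W.map f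
    rw [Submodule.Quotient.mk_eq_zero]
    constructor
    · rintro ⟨b, hb⟩
      have := congrArg Subtype.val hb
      exact (show (b : B) = f a from this) ▸ b.2
    · intro h
      exact ⟨⟨f a, h⟩, rfl⟩
  have h2 : len R (A ⧸ (W ⊔ LinearMap.ker f)) =
      len R (LinearMap.range f ⧸ LinearMap.range (Submodule.inclusion h1)) := by
    rw [← hk]
    exact len_congr (g.quotKerEquivOfSurjective hg)
  have h3 := len_of_exact (Submodule.inclusion_injective h1) (Submodule.mkQ_surjective _)
    (LinearMap.exact_map_mkQ_range _) hf
  rw [h2, h3]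
  ring

lemma len_range_add_len_quotient {u : A →ₗ[R] B} {p : B →ₗ[R] D} {q : A →ₗ[R] C}
    {i : C →ₗ[R] D} (h : p ∘ₗ u = i ∘ₗ q) (hp : IsFiniteLength R (LinearMap.range p))
    (hi : IsFiniteLength R (LinearMap.range i)) :
    len R (LinearMap.range i) + len R (B ⧸ (LinearMap.range u ⊔ LinearMap.ker p)) =
      len R (LinearMap.range p) + len R (C ⧸ (LinearMap.range q ⊔ LinearMap.ker i)) := by
  rw [len_quotient_sup_ker p _ hp, len_quotient_sup_ker i _ hi, ← LinearMap.range_comp,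
    ← LinearMap.range_comp, h]
  ring

end linear

/-- The equivalence induced on `Tor` by an equivalence in the second variable. -/
noncomputable def T.congrRight {P Q Q' : Type} [AddCommGroup P] [Module R P] [AddCommGroup Q]
    [Module R Q] [AddCommGroup Q'] [Module R Q'] (j : ℕ) (e : Q ≃ₗ[R] Q') :
    T R j P Q ≃ₗ[R] T R j P Q' :=
  LinearEquiv.ofLinearMap (T.map j LinearMap.id e.toLinearMap)
    (T.map j LinearMap.id e.symm.toLinearMap)
    (by
      have := T.map_comp j (LinearMap.id : P →ₗ[R] P) LinearMap.id e.symm.toLinearMap e.toLinearMap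
      rw [← this, LinearEquiv.comp_coe, LinearEquiv.symm_trans_self, LinearMap.comp_id,
        LinearEquiv.refl_toLinearMap, T.map_id])
    (by
      have := T.map_comp j (LinearMap.id : P →ₗ[R] P) LinearMap.id e.toLinearMap e.symm.toLinearMap
      rw [← this, LinearEquiv.comp_coe, LinearEquiv.self_trans_symm, LinearMap.comp_id,
        LinearEquiv.refl_toLinearMap, T.map_id])

section

variable [IsNoetherianRing R] [IsLocalRing R] {σ τ : Type} {x : σ → R} {M : Type}
  [AddCommGroup M] [Module R M] [Module.Finite R M] {N : Type}
  [AddCommGroup N] [Module R N] [Module.Finite R N] {Q : Ideal R}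

omit [IsNoetherianRing R] [IsLocalRing R] [Module.Finite R N] in
lemma annihilator_le_submodule (W : Submodule R N) :
    Module.annihilator R N ≤ Module.annihilator R W :=
  LinearMap.annihilator_le_of_injective W.subtype W.injective_subtype

lemma evPoly_pr_right (hI : Cuts (Ideal.span (Set.range x)) Q) [Finite σ]
    (hQ : Q ≤ Module.annihilator R M ⊔ Module.annihilator R N) (j : ℕ) :
    EvPoly fun n _ => len R (LinearMap.range (pr x M j n N)) := by
  refine (evPoly_pr hI (GrMod.const_EFG N) (fun m => hQ.trans (sup_le_sup_left
    (annihilator_le_submodule (⊤ : Submodule R N)) _)) j).congr 0 fun n _ m _ => ?_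
  have h : (T.congrRight (P := M ⧸ pw x M n) j
      (Submodule.topEquiv (R := R) (M := N))).toLinearMap ∘ₗ
      pr x M j n (⊤ : Submodule R N) = pr x M j n N ∘ₗ
      (T.congrRight (P := M) j (Submodule.topEquiv (R := R) (M := N))).toLinearMap :=
    LinearMap.ext fun t => T.map_comm j _ _ t
  have h2 := congrArg LinearMap.range h
  rw [LinearMap.range_comp, LinearMap.range_comp, LinearEquiv.range, Submodule.map_top] at h2
  rw [← h2]
  exact (len_congr (LinearEquiv.submoduleMap _ _)).symm

lemma evPoly_quotient_right (hI : Cuts (Ideal.span (Set.range x)) Q) [Finite σ]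
    (hQ : Q ≤ Module.annihilator R M ⊔ Module.annihilator R N) (j : ℕ) :
    EvPoly fun n _ => len R (T R j (M ⧸ pw x M n) N) :=
  (evPoly_quotient hI (GrMod.const_EFG N) (fun _ => hQ.trans (sup_le_sup_left
    (annihilator_le_submodule (⊤ : Submodule R N)) _)) j).congr 0 fun _ _ _ _ =>
      len_congr (T.congrRight j (Submodule.topEquiv (R := R) (M := N))).symm

end

section

variable {σ τ : Type} (x : σ → R) (y : τ → R) (M : Type)
  [AddCommGroup M] [Module R M] (N : Type) [AddCommGroup N] [Module R N]

/-- The map induced on `Tor` by the inclusion `J ^ m N → N`. -/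
noncomputable abbrev incR (j m : ℕ) (P : Type) [AddCommGroup P] [Module R P] :
    T R j P (pw y N m) →ₗ[R] T R j P N :=
  T.map j LinearMap.id (pw y N m).subtype

/-- The connecting maps into the family of `Tor` modules. -/
noncomputable abbrev dlF (j : ℕ) (n m : ℕ) :
    T R (j + 1) (M ⧸ pw x M n) (pw y N m) →ₗ[R] (GrMod.torFam j (powGr x M) (powGr y N)).E n m :=
  dl x M j n (pw y N m)

/-- The image under the connecting map of the kernel of `incR`. -/
noncomputable abbrev dlKer (j n m : ℕ) :
    Submodule R ((GrMod.torFam j (powGr x M) (powGr y N)).E n m) :=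
  (LinearMap.ker (incR y N (j + 1) m (M ⧸ pw x M n))).map (dlF x y M N j n m)

lemma dlKer_stable (j : ℕ) :
    (GrMod.torFam j (powGr x M) (powGr y N)).Stable (dlKer x y M N j) := by
  refine ⟨?_, ?_⟩
  · rintro k n m _ ⟨t, ht, rfl⟩
    have hx : pw x M n ≤ (pw x M (n + 1)).comap (x k • (LinearMap.id : M →ₗ[R] M)) := fun p hp => by
      have := (powGr x M).stable k n hp
      rwa [Submodule.mem_comap, powGr_ρ] at this
    have h1 := T.δ_naturality j (LinearMap.exact_subtype_mkQ (pw x M n))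
      (Submodule.injective_subtype _) (Submodule.mkQ_surjective _)
      (LinearMap.exact_subtype_mkQ (pw x M (n + 1)))
      (Submodule.injective_subtype _) (Submodule.mkQ_surjective _)
      ((powGr x M).x k n) (x k • LinearMap.id) ((pw x M n).mapQ _ _ hx)
      (LinearMap.ext fun p => (powGr_x x M k n p).trans rfl) rfl
      (LinearMap.id : pw y N m →ₗ[R] pw y N m)
    refine ⟨T.map (j + 1) ((pw x M n).mapQ _ _ hx) LinearMap.id t, ?_,
      (LinearMap.congr_fun h1 t).symm⟩
    have h2 := T.map_comm (j + 1) ((pw x M n).mapQ _ _ hx) (pw y N m).subtype t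
    change incR y N (j + 1) m (M ⧸ pw x M (n + 1)) _ = 0
    have ht' : T.map (j + 1) LinearMap.id (pw y N m).subtype t = 0 := ht
    rw [incR, h2, ht', map_zero]
  · rintro k n m _ ⟨t, ht, rfl⟩
    refine ⟨T.map (j + 1) LinearMap.id ((powGr y N).x k m) t, ?_,
      (T.δ_natural_right j _ _ _ _ t).symm⟩
    have h1 : (pw y N (m + 1)).subtype ∘ₗ (powGr y N).x k m = y k • (pw y N m).subtype :=
      LinearMap.ext fun p => powGr_x y N k m p
    have h2 := T.map_comp (j + 1) (LinearMap.id : (M ⧸ pw x M n) →ₗ[R] (M ⧸ pw x M n)) LinearMap.id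
      ((powGr y N).x k m) (pw y N (m + 1)).subtype
    rw [h1, LinearMap.comp_id, T.map_smul_right] at h2
    have ht' : T.map (j + 1) LinearMap.id (pw y N m).subtype t = 0 := ht
    have h3 := LinearMap.congr_fun h2 t
    rw [LinearMap.smul_apply, ht', smul_zero] at h3
    exact h3.symm

end

section

variable [IsNoetherianRing R] [IsLocalRing R] {σ τ : Type} {x : σ → R} {y : τ → R} {M : Type}
  [AddCommGroup M] [Module R M] [Module.Finite R M] {N : Type}
  [AddCommGroup N] [Module R N] [Module.Finite R N] {Q : Ideal R} [Finite σ] [Finite τ]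

omit [Finite σ] [Finite τ] in
lemma isFiniteLength_T_pw (hI : Cuts (Ideal.span (Set.range x)) Q)
    (hQ : Q ≤ Module.annihilator R M ⊔ Module.annihilator R N) (j n m : ℕ) :
    IsFiniteLength R (T R j (M ⧸ pw x M n) (pw y N m)) :=
  isFiniteLength_T hI j n (hQ.trans (sup_le_sup_left (annihilator_le_submodule _) _))

lemma evPoly_len_quotient_sup (hI : Cuts (Ideal.span (Set.range x)) Q)
    (hQ : Q ≤ Module.annihilator R M ⊔ Module.annihilator R N) (j : ℕ) :
    EvPoly fun n m => len R (T R j (M ⧸ pw x M n) (pw y N m) ⧸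
      (LinearMap.range (pr x M j n (pw y N m)) ⊔
        LinearMap.ker (incR y N j m (M ⧸ pw x M n)))) := by
  cases j with
  | zero =>
    refine (EvPoly.const 0).congr 0 fun n _ m _ => ?_
    have h : LinearMap.range (pr x M 0 n (pw y N m)) ⊔
        LinearMap.ker (incR y N 0 m (M ⧸ pw x M n)) = ⊤ := by
      rw [LinearMap.range_eq_top.2 (T.zero_map_left_surjective (pw x M n).mkQ_surjective),
        top_sup_eq]
    have := Submodule.Quotient.subsingleton_iff.2 h
    exact len_eq_zero
  | succ j =>
    have hQ' : ∀ m, Q ≤ Module.annihilator R M ⊔ Module.annihilator R ((powGr y N).P m) :=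
      fun m => hQ.trans (sup_le_sup_left (annihilator_le_submodule (pw y N m)) _)
    have hF : (GrMod.torFam j (powGr x M) (powGr y N)).EFG :=
      GrMod.torFam_EFG j _ _ (powGr_EFG x M) (powGr_EFG y N)
    have hfl := fun n m => isFiniteLength_T_pw (y := y) (N := N) hI hQ (j + 1) n m
    refine (((hF.sub (ker_incF_stable x M j _)).evPoly fun n m =>
      isFiniteLength_ker_incF hI (powGr_EFG y N) hQ' j n m).sub
      ((hF.sub (dlKer_stable x y M N j)).evPoly fun n m => ?_)).congr 0 fun n _ m _ => ?_
    · exact ((hfl n m).of_injective (Submodule.injective_subtype _)).of_surjective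
        (LinearMap.submoduleMap_surjective _ _)
    · have h1 := len_quotient_sup_ker (dl x M j n (pw y N m))
        (LinearMap.ker (incR y N (j + 1) m (M ⧸ pw x M n)))
        ((hfl n m).of_surjective (LinearMap.surjective_rangeRestrict _))
      have h2 := (exact_dl_inc x M j n (pw y N m)).linearMap_ker_eq
      rw [(exact_pr_dl x M j n (pw y N m)).linearMap_ker_eq, sup_comm] at h1
      exact h1.trans (congrArg (· - _) (len_congr (LinearEquiv.ofEq _ _ h2.symm)))

/-- The discrepancy between the length of `Tor` and a polynomial. -/
noncomputable def defect (x : σ → R) (y : τ → R) (M : Type) [AddCommGroup M] [Module R M]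
    (N : Type) [AddCommGroup N] [Module R N] (j n m : ℕ) : ℚ :=
  len R (T R j M N ⧸ (LinearMap.range (incR y N j m M) ⊔ LinearMap.ker (pr x M j n N)))

lemma evPoly_range_incR_add_defect (hI : Cuts (Ideal.span (Set.range x)) Q)
    (hQ : Q ≤ Module.annihilator R M ⊔ Module.annihilator R N) (j : ℕ) :
    EvPoly fun n m => len R (LinearMap.range (incR y N j m (M ⧸ pw x M n))) +
      defect x y M N j n m := by
  refine ((evPoly_pr_right hI hQ j).add (evPoly_len_quotient_sup (y := y) hI hQ j)).congr 0
    fun n _ m _ => len_range_add_len_quotient (LinearMap.ext fun t => (T.map_comm j _ _ t).symm)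
      ?_ ?_
  · exact (isFiniteLength_T hI j n hQ).of_injective (Submodule.injective_subtype _)
  · exact (isFiniteLength_T hI j n hQ).of_injective (Submodule.injective_subtype _)

lemma evPoly_zero (hI : Cuts (Ideal.span (Set.range x)) Q)
    (hQ : Q ≤ Module.annihilator R M ⊔ Module.annihilator R N) :
    EvPoly fun n m => len R (T R 0 (M ⧸ pw x M n) (N ⧸ pw y N m)) - defect x y M N 0 n m := by
  refine ((evPoly_quotient_right hI hQ 0).sub
    (evPoly_range_incR_add_defect (y := y) hI hQ 0)).congr 0 fun n _ m _ => ?_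
  have h := T.length_right_zero (M ⧸ pw x M n) (LinearMap.exact_subtype_mkQ (pw y N m))
    (Submodule.mkQ_surjective _)
  rw [len_quotient (LinearMap.range (incR y N 0 m (M ⧸ pw x M n))) (isFiniteLength_T hI 0 n hQ),
    len, h, len, len]
  ring

lemma evPoly_succ (hI : Cuts (Ideal.span (Set.range x)) Q)
    (hQ : Q ≤ Module.annihilator R M ⊔ Module.annihilator R N) (j : ℕ) :
    EvPoly fun n m => len R (T R (j + 1) (M ⧸ pw x M n) (N ⧸ pw y N m)) -
      (defect x y M N (j + 1) n m + defect x y M N j n m) := by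
  have hQ' : ∀ m, Q ≤ Module.annihilator R M ⊔ Module.annihilator R ((powGr y N).P m) :=
    fun m => hQ.trans (sup_le_sup_left (annihilator_le_submodule (pw y N m)) _)
  refine (((evPoly_quotient_right hI hQ (j + 1)).sub
    (evPoly_range_incR_add_defect (y := y) hI hQ (j + 1))).add
    ((evPoly_quotient hI (powGr_EFG y N) hQ' j).sub
    (evPoly_range_incR_add_defect (y := y) hI hQ j))).congr 0 fun n _ m _ => ?_
  have h := T.length_right_succ (M ⧸ pw x M n) (LinearMap.exact_subtype_mkQ (pw y N m))
    (Submodule.injective_subtype _) (Submodule.mkQ_surjective _) j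
  have h1 := isFiniteLength_T (B := N) hI (j + 1) n hQ
  have h2 := isFiniteLength_T_pw (y := y) hI hQ j n m
  have e1 := len_quotient (LinearMap.range (incR y N (j + 1) m (M ⧸ pw x M n))) h1
  have e2 := len_ker_range (incR y N j m (M ⧸ pw x M n)) h2
  have e3 : len R (T R (j + 1) (M ⧸ pw x M n) (N ⧸ pw y N m)) =
      len R (T R (j + 1) (M ⧸ pw x M n) N ⧸ LinearMap.range (incR y N (j + 1) m (M ⧸ pw x M n))) +
      len R (LinearMap.ker (incR y N j m (M ⧸ pw x M n))) := by
    rw [len, len, len, h, ENat.toNat_add]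
    · push_cast
      rfl
    · exact Module.length_ne_top_iff.2 (h1.of_surjective (Submodule.mkQ_surjective _))
    · exact Module.length_ne_top_iff.2 (h2.of_injective (Submodule.injective_subtype _))
  have e4 : len R (T R j (M ⧸ pw x M n) ((powGr y N).P m)) =
      len R (T R j (M ⧸ pw x M n) (pw y N m)) := rfl
  rw [e4]
  linarith

end

end TorAux

namespace TorAux

lemma EvPoly.eq_of_eventually_const {f : ℕ → ℕ → ℚ} (hf : EvPoly f) {q : ℕ → ℚ}
    (hq : ∀ m, ∃ n₀, ∀ n ≥ n₀, f n m = q m) : ∃ N, ∀ n ≥ N, ∀ m ≥ N, f n m = q m := by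
  obtain ⟨g, hg, N, hN⟩ := hf
  obtain ⟨p, hp⟩ := exists_mvPolynomial hg
  refine ⟨N, fun n hn m hm => ?_⟩
  let s : Polynomial ℚ := MvPolynomial.aeval ![Polynomial.X, Polynomial.C (m : ℚ)] p
  have hs : ∀ n : ℕ, s.eval (n : ℚ) = g n m := by
    intro n
    have h : (Polynomial.evalRingHom (n : ℚ)).comp
        (MvPolynomial.aeval (R := ℚ) ![Polynomial.X, Polynomial.C (m : ℚ)]).toRingHom =
        MvPolynomial.eval ![(n : ℚ), (m : ℚ)] := by
      refine MvPolynomial.ringHom_ext (fun r => by simp) (fun i => ?_)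
      fin_cases i <;> simp
    rw [hp]
    exact RingHom.congr_fun h p
  obtain ⟨n₀, hn₀⟩ := hq m
  have h0 : s - Polynomial.C (q m) = 0 := by
    refine Polynomial.eq_zero_of_infinite_isRoot _ (Set.infinite_of_injective_forall_mem
      (f := fun k : ℕ => ((k + N + n₀ : ℕ) : ℚ)) (fun a b h => ?_) fun k => ?_)
    · have : a + N + n₀ = b + N + n₀ := Nat.cast_injective h
      omega
    · rw [Set.mem_ofPred_eq, Polynomial.IsRoot, Polynomial.eval_sub, Polynomial.eval_C, hs,
        ← hN _ (by omega) m hm, hn₀ _ (by omega), sub_self]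
  rw [hN n hn m hm, ← hs, sub_eq_zero.1 h0, Polynomial.eval_C]

section filtration

variable {R : Type} [CommRing R] {V : Type} [AddCommGroup V] [Module R V]

/-- Filtrations that are eventually `I`-stable up to inclusion. -/
structure Filtr (I : Ideal R) (W : ℕ → Submodule R V) : Prop where
  anti : ∀ n, W (n + 1) ≤ W n
  pow_le : ∀ n, I ^ n • ⊤ ≤ W n
  succ_le : ∃ N, ∀ n ≥ N, W (n + 1) ≤ I • W n

namespace Filtr

variable {I J Q : Ideal R} {W U : ℕ → Submodule R V}

lemma exists_le (h : Filtr I W) (k : ℕ) : ∃ N, ∀ n ≥ N, W n ≤ I ^ k • ⊤ := by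
  obtain ⟨N, hN⟩ := h.succ_le
  refine ⟨N + k, fun n hn => (antitone_nat_of_succ_le h.anti hn).trans ?_⟩
  clear hn
  induction k with
  | zero => simp
  | succ k ih =>
    rw [pow_succ', Submodule.mul_smul]
    exact (hN (N + k) (by omega)).trans (Submodule.smul_mono le_rfl ih)

variable [IsLocalRing R]

lemma eventually_bot (h : Filtr I W) (hI : I ≤ maximalIdeal R) (hV : IsFiniteLength R V) :
    ∃ N, ∀ n ≥ N, W n = ⊥ := by
  obtain ⟨k, hk⟩ := exists_pow_smul_eq_zero hV
  obtain ⟨N, hN⟩ := h.exists_le k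
  refine ⟨N, fun n hn => eq_bot_iff.2 ((hN n hn).trans (Submodule.smul_le.2 fun r hr v _ => ?_))⟩
  exact (Submodule.mem_bot R).2 (hk r (Ideal.pow_right_mono hI k hr) v)

variable [IsNoetherianRing R] [Module.Finite R V]

lemma isFiniteLength_quotient (h : Filtr I W) (hI : Cuts I Q)
    (hQ : Q ≤ Module.annihilator R V) (n : ℕ) : IsFiniteLength R (V ⧸ W n) := by
  refine hI.isFiniteLength n (fun r hr => ?_)
    (hQ.trans (LinearMap.annihilator_le_of_surjective _ (W n).mkQ_surjective))
  rw [Module.mem_annihilator]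
  intro v
  obtain ⟨v, rfl⟩ := Submodule.Quotient.mk_surjective _ v
  rw [← Submodule.Quotient.mk_smul, Submodule.Quotient.mk_eq_zero]
  exact h.pow_le n (Submodule.smul_mem_smul hr trivial)

lemma eventually_le (h : Filtr I W) (h' : Filtr J U) (hI : Cuts I Q) (hJ : Cuts J Q)
    (hQ : Q ≤ Module.annihilator R V) (m : ℕ) : ∃ N, ∀ n ≥ N, W n ≤ U m := by
  obtain ⟨k, hk⟩ := exists_pow_smul_eq_zero (h'.isFiniteLength_quotient hJ hQ m)
  obtain ⟨N, hN⟩ := h.exists_le k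
  refine ⟨N, fun n hn => (hN n hn).trans (Submodule.smul_le.2 fun r hr v _ => ?_)⟩
  rw [← Submodule.Quotient.mk_eq_zero, Submodule.Quotient.mk_smul]
  exact hk r (Ideal.pow_right_mono hI.le_maximalIdeal k hr) _

lemma len_quotient_succ (h : Filtr I W) (hI : Cuts I Q)
    (hQ : Q ≤ Module.annihilator R V) (n : ℕ) :
    len R (V ⧸ W (n + 1)) = len R (LinearMap.ker (Submodule.factor (h.anti n))) +
      len R (V ⧸ W n) := by
  rw [len_ker_range (Submodule.factor (h.anti n)) (h.isFiniteLength_quotient hI hQ (n + 1)),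
    LinearMap.range_eq_top.2 (Submodule.factor_surjective _), len_congr Submodule.topEquiv]

lemma isFiniteLength_of_len_succ (h : Filtr I W) (hI : Cuts I Q)
    (hQ : Q ≤ Module.annihilator R V)
    (hn : ∃ N, ∀ n ≥ N, len R (V ⧸ W (n + 1)) = len R (V ⧸ W n)) : IsFiniteLength R V := by
  obtain ⟨N, hN⟩ := hn
  obtain ⟨N', hN'⟩ := h.succ_le
  set n := max N N'
  have h1 := h.len_quotient_succ hI hQ n
  rw [hN n (le_max_left _ _), eq_comm, add_eq_right, len, Nat.cast_eq_zero, ENat.toNat_eq_zero,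
    or_iff_left (Module.length_ne_top_iff.2 ((h.isFiniteLength_quotient hI hQ (n + 1)).of_injective
      (Submodule.injective_subtype _))), Module.length_eq_zero_iff,
    Submodule.subsingleton_iff_eq_bot, LinearMap.ker_eq_bot] at h1
  have h2 : W n ≤ I • W n := by
    refine le_trans (fun v hv => ?_) (hN' n (le_max_right _ _))
    rw [← Submodule.Quotient.mk_eq_zero] at hv ⊢
    exact h1 (hv.trans (map_zero _).symm)
  have h3 : W n = ⊥ := Submodule.eq_bot_of_le_smul_of_le_jacobson_bot I _
    (IsNoetherian.noetherian _) h2 (hI.le_maximalIdeal.trans (maximalIdeal_le_jacobson _))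
  have h4 := h.isFiniteLength_quotient hI hQ n
  rw [h3] at h4
  exact (Submodule.quotEquivOfEqBot ⊥ rfl).isFiniteLength h4

end Filtr

variable {I J Q : Ideal R} [IsLocalRing R] [IsNoetherianRing R]

omit [IsNoetherianRing R] in
lemma evPoly_len_quotient_of_isFiniteLength {W U : ℕ → Submodule R V} (hW : Filtr I W)
    (hU : Filtr J U) (hI : I ≤ maximalIdeal R) (hJ : J ≤ maximalIdeal R)
    (hV : IsFiniteLength R V) : EvPoly fun n m => len R (V ⧸ (U m ⊔ W n)) := by
  obtain ⟨N, hN⟩ := hW.eventually_bot hI hV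
  obtain ⟨N', hN'⟩ := hU.eventually_bot hJ hV
  refine (EvPoly.const (len R V)).congr (max N N') fun n hn m hm => ?_
  rw [hN n (by omega), hN' m (by omega), sup_bot_eq]
  exact len_congr (Submodule.quotEquivOfEqBot ⊥ rfl)

lemma isFiniteLength_of_evPoly {V' : Type} [AddCommGroup V'] [Module R V'] [Module.Finite R V]
    [Module.Finite R V'] {W U : ℕ → Submodule R V} {W' U' : ℕ → Submodule R V'}
    (hW : Filtr I W) (hU : Filtr J U) (hW' : Filtr I W') (hU' : Filtr J U')
    (hI : Cuts I Q) (hJ : Cuts J Q) (hQ : Q ≤ Module.annihilator R V)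
    (hQ' : Q ≤ Module.annihilator R V')
    (h : EvPoly fun n m => len R (V ⧸ (U m ⊔ W n)) + len R (V' ⧸ (U' m ⊔ W' n))) :
    IsFiniteLength R V ∧ IsFiniteLength R V' := by
  obtain ⟨N, hN⟩ := h.eq_of_eventually_const
    (q := fun m => len R (V ⧸ U m) + len R (V' ⧸ U' m)) fun m => by
      obtain ⟨N₁, h₁⟩ := hW.eventually_le hU hI hJ hQ m
      obtain ⟨N₂, h₂⟩ := hW'.eventually_le hU' hI hJ hQ' m
      refine ⟨max N₁ N₂, fun n hn => ?_⟩
      rw [sup_eq_left.2 (h₁ n (by omega)), sup_eq_left.2 (h₂ n (by omega))]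
  obtain ⟨N', hN'⟩ := h.swap.eq_of_eventually_const
    (q := fun n => len R (V ⧸ W n) + len R (V' ⧸ W' n)) fun n => by
      obtain ⟨N₁, h₁⟩ := hU.eventually_le hW hJ hI hQ n
      obtain ⟨N₂, h₂⟩ := hU'.eventually_le hW' hJ hI hQ' n
      refine ⟨max N₁ N₂, fun m hm => ?_⟩
      rw [sup_eq_right.2 (h₁ m (by omega)), sup_eq_right.2 (h₂ m (by omega))]
  have key : ∀ m ≥ max N N', len R (V ⧸ U (m + 1)) = len R (V ⧸ U m) ∧
      len R (V' ⧸ U' (m + 1)) = len R (V' ⧸ U' m) := by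
    intro m hm
    have a1 := hN (max N N') (by omega) m (by omega)
    have a2 := hN (max N N') (by omega) (m + 1) (by omega)
    have b1 := hN' m (by omega) (max N N') (by omega)
    have b2 := hN' (m + 1) (by omega) (max N N') (by omega)
    have c1 := hU.len_quotient_succ hJ hQ m
    have c2 := hU'.len_quotient_succ hJ hQ' m
    have d1 : 0 ≤ len R (LinearMap.ker (Submodule.factor (hU.anti m))) := Nat.cast_nonneg _
    have d2 : 0 ≤ len R (LinearMap.ker (Submodule.factor (hU'.anti m))) := Nat.cast_nonneg _
    constructor <;> linarith
  exact ⟨hU.isFiniteLength_of_len_succ hJ hQ ⟨_, fun m hm => (key m hm).1⟩,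
    hU'.isFiniteLength_of_len_succ hJ hQ' ⟨_, fun m hm => (key m hm).2⟩⟩

end filtration

end TorAux

namespace TorAux

variable {R : Type} [CommRing R] [IsNoetherianRing R] {σ τ : Type} [Finite σ] [Finite τ]
  (x : σ → R) (y : τ → R) (M : Type) [AddCommGroup M] [Module R M] [Module.Finite R M]
  (N : Type) [AddCommGroup N] [Module R N] [Module.Finite R N] (j : ℕ)

lemma filtr_left : Filtr (Ideal.span (Set.range x))
    fun n => LinearMap.ker (pr x M j n N) where
  anti n := ker_pr_anti x M j n N
  pow_le n := by
    refine Submodule.smul_le.2 fun r hr v _ => ?_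
    rw [LinearMap.mem_ker, map_smul]
    exact T.smul_eq_zero_left j (Module.mem_annihilator.1 (pw_le_annihilator x M n hr)) _
  succ_le := by
    obtain ⟨K, hK⟩ := (GrMod.torFam_EFG j _ _ (powGr_EFG x M)
      (GrMod.const_EFG (R := R) N)).gen
    refine ⟨K, fun n hn => ?_⟩
    rw [(exact_inc_pr x j (n + 1) N).linearMap_ker_eq, (exact_inc_pr x j n N).linearMap_ker_eq]
    rintro _ ⟨t, rfl⟩
    obtain ⟨t, rfl⟩ := T.map_surjective j (f' := LinearMap.id)
      (g' := (Submodule.topEquiv (R := R) (M := N)).symm.toLinearMap)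
      (LinearMap.id_comp (LinearMap.id : pw x M (n + 1) →ₗ[R] pw x M (n + 1)))
      (show (⊤ : Submodule R N).subtype ∘ₗ _ = LinearMap.id from rfl) t
    let p : (GrMod.torFam j (powGr x M) (GrMod.const N)).E (n + 1) K →ₗ[R] T R j M N :=
      inc x M j (n + 1) N ∘ₗ T.map j LinearMap.id (⊤ : Submodule R N).subtype
    suffices h : ⊤ ≤ (Ideal.span (Set.range x) • LinearMap.range (inc x M j n N)).comap p from
      h (Submodule.mem_top (x := t))
    refine ((hK n hn K le_rfl).1).trans (iSup_le fun k => ?_)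
    rintro _ ⟨e, rfl⟩
    have h1 := inc_X x M j (GrMod.const N) k n K e
    have h2 : p ((GrMod.torFam j (powGr x M) (GrMod.const N)).X k n K e) =
        T.map j LinearMap.id (⊤ : Submodule R N).subtype
          (x k • incF x M j (GrMod.const N) n K e) := by
      rw [← h1]
      exact T.map_comm j _ _ _ |>.symm
    rw [Submodule.mem_comap, h2, map_smul]
    exact Submodule.smul_mem_smul (Ideal.subset_span ⟨k, rfl⟩)
      ⟨T.map j LinearMap.id (⊤ : Submodule R N).subtype e, (T.map_comm j _ _ e).symm⟩

lemma filtr_right : Filtr (Ideal.span (Set.range y))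
    fun m => LinearMap.range (incR y N j m M) where
  anti m := by
    rintro _ ⟨t, rfl⟩
    exact ⟨T.map j LinearMap.id (Submodule.inclusion (pw_succ_le y N m)) t,
      LinearMap.congr_fun (T.map_comp j LinearMap.id LinearMap.id
        (Submodule.inclusion (pw_succ_le y N m)) (pw y N m).subtype) t |>.symm⟩
  pow_le m := by
    rw [← (T.exact_right M (LinearMap.exact_subtype_mkQ (pw y N m))
      (Submodule.injective_subtype _) (Submodule.mkQ_surjective _) j).linearMap_ker_eq]
    refine Submodule.smul_le.2 fun r hr v _ => ?_
    rw [LinearMap.mem_ker, map_smul]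
    exact T.smul_eq_zero_right j (Module.mem_annihilator.1 (pw_le_annihilator y N m hr)) _
  succ_le := by
    obtain ⟨K, hK⟩ := (GrMod.torFam_EFG j _ _ (GrMod.const_EFG (R := R) M)
      (powGr_EFG y N)).gen
    refine ⟨K, fun m hm => ?_⟩
    rintro _ ⟨t, rfl⟩
    obtain ⟨t, rfl⟩ := T.map_surjective j
      (f' := (Submodule.topEquiv (R := R) (M := M)).symm.toLinearMap) (g' := LinearMap.id)
      (show (⊤ : Submodule R M).subtype ∘ₗ _ = LinearMap.id from rfl)
      (LinearMap.id_comp (LinearMap.id : pw y N (m + 1) →ₗ[R] pw y N (m + 1))) t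
    let p : (GrMod.torFam j (GrMod.const M) (powGr y N)).E K (m + 1) →ₗ[R] T R j M N :=
      T.map j (⊤ : Submodule R M).subtype (pw y N (m + 1)).subtype
    have hp : ∀ m s, incR y N j m M (T.map j (⊤ : Submodule R M).subtype LinearMap.id s) =
        T.map j (⊤ : Submodule R M).subtype (pw y N m).subtype s := fun m s =>
      (LinearMap.congr_fun (T.map_comp j (⊤ : Submodule R M).subtype LinearMap.id
        LinearMap.id (pw y N m).subtype) s).symm
    suffices h : ⊤ ≤ (Ideal.span (Set.range y) • LinearMap.range (incR y N j m M)).comap p by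
      rw [hp]
      exact h (Submodule.mem_top (x := t))
    refine ((hK K le_rfl m hm).2).trans (iSup_le fun k => ?_)
    rintro _ ⟨e, rfl⟩
    have h1 : (pw y N (m + 1)).subtype ∘ₗ (powGr y N).x k m = y k • (pw y N m).subtype :=
      LinearMap.ext fun p => powGr_x y N k m p
    have h2 := T.map_comp j (LinearMap.id : (⊤ : Submodule R M) →ₗ[R] (⊤ : Submodule R M))
      (⊤ : Submodule R M).subtype ((powGr y N).x k m) (pw y N (m + 1)).subtype
    rw [h1, LinearMap.comp_id, T.map_smul_right] at h2
    have h3 : p ((GrMod.torFam j (GrMod.const M) (powGr y N)).Y k K m e) =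
        y k • T.map j (⊤ : Submodule R M).subtype (pw y N m).subtype e :=
      (LinearMap.congr_fun h2 e).symm
    rw [Submodule.mem_comap, h3]
    exact Submodule.smul_mem_smul (Ideal.subset_span ⟨k, rfl⟩) ⟨_, hp m e⟩

end TorAux

namespace TorAux

lemma mul_mem_polyFun {g : ℕ → ℕ → ℚ} (hg : g ∈ polyFun) :
    (fun n m : ℕ => (n : ℚ) * g n m) ∈ polyFun := by
  induction hg using Submodule.span_induction with
  | mem x hx =>
    obtain ⟨⟨a, b⟩, rfl⟩ := hx
    convert add_mem (Submodule.smul_mem _ ((a : ℚ) + 1) (choose_mem_polyFun (a + 1) b))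
      (Submodule.smul_mem _ (a : ℚ) (choose_mem_polyFun a b)) using 1
    ext n m
    have h : n.choose (a + 1) * (a + 1) + a * n.choose a = n * n.choose a := by
      rw [Nat.choose_succ_right_eq]
      rcases le_or_gt a n with h | h
      · obtain ⟨c, rfl⟩ := Nat.exists_eq_add_of_le h
        rw [Nat.add_sub_cancel_left]
        ring
      · simp [Nat.choose_eq_zero_of_lt h]
    have h' := congrArg (Nat.cast : ℕ → ℚ) h
    push_cast at h'
    simp only [Pi.add_apply, Pi.smul_apply, smul_eq_mul]
    linear_combination (-(m.choose b : ℚ)) * h'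
  | zero =>
    convert zero_mem polyFun using 1
    ext n m
    simp
  | add x y _ _ hx hy =>
    convert add_mem hx hy using 1
    ext n m
    simp [mul_add]
  | smul c x _ hx =>
    convert Submodule.smul_mem _ c hx using 1
    ext n m
    simp [mul_left_comm]

lemma eval_mem_polyFun (p : MvPolynomial (Fin 2) ℚ) :
    (fun n m : ℕ => MvPolynomial.eval ![(n : ℚ), (m : ℚ)] p) ∈ polyFun := by
  induction p using MvPolynomial.induction_on with
  | C a =>
    convert Submodule.smul_mem _ a (choose_mem_polyFun 0 0) using 1
    ext n m
    simp
  | add p q hp hq =>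
    convert add_mem hp hq using 1
    ext n m
    simp
  | mul_X p i hp =>
    fin_cases i
    · convert mul_mem_polyFun hp using 1
      ext n m
      simp [mul_comm]
    · convert polyFun_swap (mul_mem_polyFun (polyFun_swap hp)) using 1
      ext n m
      simp [mul_comm]

lemma eventuallyPolynomial₂_iff {f : ℕ → ℕ → WithBot ℕ∞} {g : ℕ → ℕ → ℕ}
    (h : ∀ m n, f m n = (g m n : ℕ∞)) :
    EventuallyPolynomial₂ f ↔ EvPoly fun m n => (g m n : ℚ) := by
  constructor
  · rintro ⟨p, m₀, n₀, hp⟩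
    refine ⟨_, eval_mem_polyFun p, max m₀ n₀, fun m hm n hn => ?_⟩
    obtain ⟨c, hc, hc'⟩ := hp m (by omega) n (by omega)
    rw [h] at hc
    have : g m n = c := by exact_mod_cast hc
    exact (congrArg (Nat.cast : ℕ → ℚ) this).trans hc'
  · rintro ⟨q, hq, K, hK⟩
    obtain ⟨p, hp⟩ := exists_mvPolynomial hq
    exact ⟨p, K, K, fun m hm n hn => ⟨g m n, h m n, (hK m hm n hn).trans (hp m n)⟩⟩

section

variable {R : Type} [CommRing R]

/-- `T` computes `Tor`. -/
noncomputable def torEquiv (j : ℕ) (P Q : Type) [AddCommGroup P] [Module R P] [AddCommGroup Q]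
    [Module R Q] : ↥(TorM R j P Q) ≃ₗ[R] T R j P Q :=
  (torIso j (ModuleCat.of R P) (ModuleCat.of R Q)).toLinearEquiv

lemma modLength_eq_of_linearEquiv {A B : Type} [AddCommGroup A] [Module R A] [AddCommGroup B]
    [Module R B] (e : A ≃ₗ[R] B) (hB : IsFiniteLength R B) :
    modLength R A = (((Module.length R B).toNat : ℕ) : ℕ∞) := by
  rw [ENat.natCast_toNat (Module.length_ne_top_iff.2 hB), ← e.length_eq, Module.coe_length]
  rfl

lemma isFiniteLength_congr {A B : Type} [AddCommGroup A] [Module R A] [AddCommGroup B]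
    [Module R B] (e : A ≃ₗ[R] B) : IsFiniteLength R A ↔ IsFiniteLength R B :=
  ⟨fun h => h.of_surjective e.surjective, fun h => h.of_surjective e.symm.surjective⟩

lemma sup_annihilator_le (j : ℕ) {M N : Type} [AddCommGroup M] [Module R M] [AddCommGroup N]
    [Module R N] : Module.annihilator R M ⊔ Module.annihilator R N ≤
    Module.annihilator R (T R j M N) :=
  sup_le (T.annihilator_left j) (T.annihilator_right j)

variable [IsNoetherianRing R] [IsLocalRing R] {σ τ : Type} [Finite σ] [Finite τ] {x : σ → R}
  {y : τ → R} {M : Type} [AddCommGroup M] [Module R M] [Module.Finite R M] {N : Type}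
  [AddCommGroup N] [Module R N] [Module.Finite R N]

lemma evPoly_defect (hI : Cuts (Ideal.span (Set.range x))
    (Module.annihilator R M ⊔ Module.annihilator R N))
    (hJ : Cuts (Ideal.span (Set.range y)) (Module.annihilator R M ⊔ Module.annihilator R N))
    (j : ℕ) (h : IsFiniteLength R (T R j M N)) : EvPoly (defect x y M N j) :=
  evPoly_len_quotient_of_isFiniteLength (filtr_left x M N j) (filtr_right y M N j)
    hI.le_maximalIdeal hJ.le_maximalIdeal h

lemma evPoly_len_tor_iff (hI : Cuts (Ideal.span (Set.range x))
    (Module.annihilator R M ⊔ Module.annihilator R N))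
    (hJ : Cuts (Ideal.span (Set.range y)) (Module.annihilator R M ⊔ Module.annihilator R N))
    (i : ℕ) : (EvPoly fun n m => len R (T R i (M ⧸ pw x M n) (N ⧸ pw y N m))) ↔
      IsFiniteLength R (T R i M N) ∧ ∀ j, j + 1 = i → IsFiniteLength R (T R j M N) := by
  have (j : ℕ) : Module.Finite R (T R j M N) := T.finite j
  have key (j k : ℕ) (h : EvPoly fun n m => defect x y M N j n m + defect x y M N k n m) :
      IsFiniteLength R (T R j M N) ∧ IsFiniteLength R (T R k M N) :=
    isFiniteLength_of_evPoly (filtr_left x M N j) (filtr_right y M N j) (filtr_left x M N k)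
      (filtr_right y M N k) hI hJ (sup_annihilator_le j) (sup_annihilator_le k) h
  cases i with
  | zero =>
    have h0 := evPoly_zero (y := y) hI le_rfl
    constructor
    · intro h
      have h1 : EvPoly (defect x y M N 0) := (h.sub h0).congr 0 fun n _ m _ => by ring
      exact ⟨(key 0 0 (h1.add h1)).1, fun j hj => absurd hj j.succ_ne_zero⟩
    · rintro ⟨h, -⟩
      exact (h0.add (evPoly_defect hI hJ 0 h)).congr 0 fun n _ m _ => by ring
  | succ i =>
    have h0 := evPoly_succ (y := y) hI le_rfl i
    constructor
    · intro h
      obtain ⟨h1, h2⟩ := key (i + 1) i ((h.sub h0).congr 0 fun n _ m _ => by ring)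
      exact ⟨h1, fun j hj => Nat.succ_injective hj ▸ h2⟩
    · rintro ⟨h, h'⟩
      exact (h0.add ((evPoly_defect hI hJ (i + 1) h).add
        (evPoly_defect hI hJ i (h' i rfl)))).congr 0 fun n _ m _ => by ring

end

end TorAux

theorem stmt3 (R : Type) [CommRing R] [IsNoetherianRing R] [IsLocalRing R]
    (I J : Ideal R)
    (M : Type) [AddCommGroup M] [Module R M] [Module.Finite R M]
    (N : Type) [AddCommGroup N] [Module R N] [Module.Finite R N]
    (i : ℕ)
    (hprimI : (I ⊔ Module.annihilator R M ⊔ Module.annihilator R N).radical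
      = maximalIdeal R)
    (hprimJ : (J ⊔ Module.annihilator R M ⊔ Module.annihilator R N).radical
      = maximalIdeal R) :
    EventuallyPolynomial₂ (fun m n =>
      modLength R ↥(TorM R i (M ⧸ (I ^ n • (⊤ : Submodule R M)))
        (N ⧸ (J ^ m • (⊤ : Submodule R N))))) ↔
    (IsFiniteLength R ↥(TorM R i M N) ∧
      ∀ j : ℕ, j + 1 = i → IsFiniteLength R ↥(TorM R j M N)) := by
  obtain ⟨r, x, rfl⟩ := Submodule.fg_iff_exists_fin_generating_family.1 (IsNoetherian.noetherian I)
  obtain ⟨s, y, rfl⟩ := Submodule.fg_iff_exists_fin_generating_family.1 (IsNoetherian.noetherian J)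
  rw [sup_assoc] at hprimI hprimJ
  have hlen (m n : ℕ) := TorAux.modLength_eq_of_linearEquiv
    (TorAux.torEquiv i (M ⧸ TorAux.pw x M n) (N ⧸ TorAux.pw y N m))
    (TorAux.isFiniteLength_T hprimI i n (sup_le_sup_left
      (LinearMap.annihilator_le_of_surjective _ (TorAux.pw y N m).mkQ_surjective) _))
  rw [TorAux.eventuallyPolynomial₂_iff hlen, TorAux.isFiniteLength_congr (TorAux.torEquiv i M N)]
  simp only [fun j => TorAux.isFiniteLength_congr (TorAux.torEquiv (R := R) j M N)]
  rw [← TorAux.evPoly_len_tor_iff hprimI hprimJ]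
  exact ⟨TorAux.EvPoly.swap, TorAux.EvPoly.swap⟩
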